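/- arXiv:2103.09266 — 7 statements merged into one kernel-verified Lean document; each statement's English description precedes it below -/
import Mathlib

section
/- If f : S_X → S_Y is a bijective isometry between the unit spheres of two finite-dimensional real Banach spaces X and Y, then f(−x) = −f(x) for every x ∈ S_X. -/
open Metric Set

/-- The averaged map `z ↦ (7/8) z + (1/8) h z` is onto the sphere. -/
lemma tingley_surj {X : Type*} [NormedAddCommGroup X] [NormedSpace ℝ X] [CompleteSpace X]
    (h : sphere (0 : X) 1 → sphere (0 : X) 1)
    (hi : ∀ a b, ‖(h a : X) - h b‖ = ‖(a : X) - b‖)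
    (h2 : ∀ a : sphere (0 : X) 1, ‖(a : X) + h a‖ = 2) (y : sphere (0 : X) 1) :
    ∃ z : sphere (0 : X) 1, (7/8 : ℝ) • (z : X) + (1/8 : ℝ) • (h z : X) = y := by
  classical
  have nS : ∀ a : sphere (0 : X) 1, ‖(a : X)‖ = 1 := fun a => by simp
  -- polar decomposition
  have polar : ∀ z : X, ∃ s : sphere (0 : X) 1, z = ‖z‖ • (s : X) := by
    intro z
    by_cases hz : z = 0
    · exact ⟨y, by simp [hz]⟩
    · have hz' : ‖z‖ ≠ 0 := norm_ne_zero_iff.mpr hz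
      refine ⟨⟨‖z‖⁻¹ • z, ?_⟩, ?_⟩
      · simp [norm_smul, hz']
      · simp [smul_smul, hz']
  choose p hp using polar
  let w : X → X := fun z => ‖z‖ • ((h (p z) : X) - p z)
  have lip : ∀ a b : X, ‖w a - w b‖ ≤ 4 * ‖a - b‖ := by
    intro a b
    have e : w a - w b = (‖a‖ - ‖b‖) • (h (p a) : X)
        + ‖b‖ • ((h (p a) : X) - h (p b)) - (a - b) := by
      have : a - b = ‖a‖ • (p a : X) - ‖b‖ • (p b : X) := by rw [← hp a, ← hp b]
      rw [this]
      simp only [w]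
      module
    have e1 : ‖(‖a‖ - ‖b‖) • (h (p a) : X)‖ ≤ ‖a - b‖ := by
      rw [norm_smul, nS, mul_one]; exact abs_norm_sub_norm_le a b
    have e2 : ‖‖b‖ • ((h (p a) : X) - h (p b))‖ ≤ 2 * ‖a - b‖ := by
      rw [norm_smul, hi, ← norm_smul]
      have : ‖b‖ • ((p a : X) - p b) = (a - b) - (‖a‖ - ‖b‖) • (p a : X) := by
        have : a - b = ‖a‖ • (p a : X) - ‖b‖ • (p b : X) := by rw [← hp a, ← hp b]
        rw [this]; module
      rw [this]
      have e3 : ‖(‖a‖ - ‖b‖) • (p a : X)‖ ≤ ‖a - b‖ := by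
        rw [norm_smul, nS, mul_one]; exact abs_norm_sub_norm_le a b
      have := norm_sub_le (a - b) ((‖a‖ - ‖b‖) • (p a : X))
      linarith
    rw [e]
    have := norm_sub_le ((‖a‖ - ‖b‖) • (h (p a) : X) + ‖b‖ • ((h (p a) : X) - h (p b))) (a - b)
    have := norm_add_le ((‖a‖ - ‖b‖) • (h (p a) : X)) (‖b‖ • ((h (p a) : X) - h (p b)))
    linarith
  let F : X → X := fun z => (y : X) - (1/8 : ℝ) • w z
  have hF : ContractingWith (1/2) F := by
    refine ⟨by rw [← NNReal.coe_lt_coe]; norm_num, LipschitzWith.of_dist_le_mul ?_⟩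
    intro a b
    have e : F a - F b = (1/8 : ℝ) • (w b - w a) := by simp only [F]; module
    rw [dist_eq_norm, e, norm_smul, dist_eq_norm, norm_sub_rev]
    have := lip a b
    norm_num
    linarith
  obtain ⟨z, hz⟩ : ∃ z, F z = z := ⟨hF.fixedPoint F, hF.fixedPoint_isFixedPt⟩
  have nQ : ∀ a : sphere (0 : X) 1, ‖(7/8 : ℝ) • (a : X) + (1/8 : ℝ) • (h a : X)‖ = 1 := by
    intro a
    have b1 : ‖(7/8 : ℝ) • (a : X) + (1/8 : ℝ) • (h a : X)‖ ≤ 1 := by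
      refine (norm_add_le _ _).trans ?_
      rw [norm_smul, norm_smul, nS, nS]; norm_num
    have b2 : ‖(1/8 : ℝ) • (a : X) + (7/8 : ℝ) • (h a : X)‖ ≤ 1 := by
      refine (norm_add_le _ _).trans ?_
      rw [norm_smul, norm_smul, nS, nS]; norm_num
    have := norm_add_le ((7/8 : ℝ) • (a : X) + (1/8 : ℝ) • (h a : X))
      ((1/8 : ℝ) • (a : X) + (7/8 : ℝ) • (h a : X))
    have e : (7/8 : ℝ) • (a : X) + (1/8 : ℝ) • (h a : X)
      + ((1/8 : ℝ) • (a : X) + (7/8 : ℝ) • (h a : X)) = (a : X) + h a := by module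
    rw [e, h2] at this
    linarith
  have hy : (y : X) = ‖z‖ • ((7/8 : ℝ) • (p z : X) + (1/8 : ℝ) • (h (p z) : X)) := by
    have e1 : (y : X) = z + (1/8 : ℝ) • w z := by
      rw [← sub_eq_iff_eq_add]; exact hz
    rw [e1]
    nth_rewrite 1 [hp z]
    simp only [w]
    module
  have hn : ‖z‖ = 1 := by
    have := congrArg norm hy
    rw [norm_smul, nQ, nS, norm_norm, mul_one] at this
    exact this.symm
  exact ⟨p z, by rw [hy, hn, one_smul]⟩

lemma tingley_key {X : Type*} [NormedAddCommGroup X] [NormedSpace ℝ X] [FiniteDimensional ℝ X]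
    (h : sphere (0 : X) 1 → sphere (0 : X) 1)
    (hi : ∀ a b, ‖(h a : X) - h b‖ = ‖(a : X) - b‖)
    (h2 : ∀ a : sphere (0 : X) 1, ‖(a : X) + h a‖ = 2) (x : sphere (0 : X) 1) : h x = x := by
  have : CompleteSpace X := FiniteDimensional.complete ℝ X
  have : ProperSpace X := FiniteDimensional.proper ℝ X
  have nS : ∀ a : sphere (0 : X) 1, ‖(a : X)‖ = 1 := fun a => by simp
  choose g hg using tingley_surj h hi h2
  have hc : Continuous h := by
    refine (Isometry.of_dist_eq fun a b => ?_).continuous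
    rw [Subtype.dist_eq, Subtype.dist_eq, dist_eq_norm, dist_eq_norm, hi]
  have hrc : Continuous fun a : sphere (0 : X) 1 => ‖(h a : X) - a‖ := by fun_prop
  obtain ⟨x0, -, hx0⟩ := (isCompact_univ (X := sphere (0 : X) 1)).exists_isMaxOn
    ⟨x, mem_univ x⟩ hrc.continuousOn
  have hmax : ∀ a : sphere (0 : X) 1, ‖(h a : X) - a‖ ≤ ‖(h x0 : X) - x0‖ :=
    fun a => hx0 (mem_univ a)
  set R := ‖(h x0 : X) - x0‖ with hR
  have step : ∀ a : sphere (0 : X) 1, ‖(a : X) - g a‖ = 1/8 * ‖(h (g a) : X) - g a‖ := by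
    intro a
    have e : (a : X) - g a = (1/8 : ℝ) • ((h (g a) : X) - g a) := by
      have := hg a
      rw [← this]; module
    rw [e, norm_smul]; norm_num
  have mono : ∀ a, ‖(h a : X) - a‖ ≤ ‖(h (g a) : X) - g a‖ := by
    intro a
    have e : (h a : X) - a = ((h a : X) - h (g a)) + (7/8 : ℝ) • ((h (g a) : X) - g a) := by
      have := hg a
      generalize (h a : X) = u at *
      rw [← this]; module
    rw [e]
    refine (norm_add_le _ _).trans ?_
    rw [hi, step, norm_smul]; norm_num; linarith
  let z : ℕ → sphere (0 : X) 1 := fun n => g^[n] x0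
  have zs : ∀ n, z (n+1) = g (z n) := fun n => Function.iterate_succ_apply' g n x0
  have rz : ∀ n, ‖(h (z n) : X) - z n‖ = R := by
    intro n
    induction n with
    | zero => rfl
    | succ k ih =>
      refine le_antisymm (hmax _) ?_
      rw [zs, ← ih]; exact mono _
  have dz : ∀ n, ‖(z n : X) - z (n+1)‖ = 1/8 * R := by
    intro n
    rw [← rz (n+1), zs]; exact step _
  have far : ∀ n i, ‖(z i : X) - z (i+n)‖ ≤ n * (1/8 * R) := by
    intro n i
    induction n with
    | zero => simp
    | succ k ih =>
      have := norm_sub_le_norm_sub_add_norm_sub (z i : X) (z (i+k)) (z (i+(k+1)))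
      have d := dz (i+k)
      rw [add_assoc] at d
      push_cast
      linarith
  have main : ∀ n i : ℕ, (1 + n * (1/8)) * R ≤ ‖(h (z i) : X) - z (i+n)‖ := by
    intro n i
    induction n with
    | zero => simp [rz]
    | succ k ih =>
      have e : (h (z i) : X) - z (i+k) = (7/8 : ℝ) • ((h (z i) : X) - z (i+(k+1)))
          + (1/8 : ℝ) • ((h (z i) : X) - h (z (i+(k+1)))) := by
        have := hg (z (i+k))
        rw [← zs, add_assoc] at this
        rw [← this]; module
      have n1 := norm_add_le ((7/8 : ℝ) • ((h (z i) : X) - z (i+(k+1))))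
        ((1/8 : ℝ) • ((h (z i) : X) - h (z (i+(k+1)))))
      rw [← e, norm_smul, norm_smul, hi] at n1
      have := far (k+1) i
      norm_num at n1
      push_cast at this ⊢
      linarith
  have bd : ∀ n : ℕ, (1 + n * (1/8)) * R ≤ 2 := by
    intro n
    refine (main n 0).trans ((norm_sub_le _ _).trans ?_)
    rw [nS, nS]; norm_num
  have R0 : R ≤ 0 := by
    by_contra hpos
    push Not at hpos
    obtain ⟨n, hn⟩ := exists_nat_gt (16 / R)
    rw [div_lt_iff₀ hpos] at hn
    have := bd n
    linarith
  have : ‖(h x : X) - x‖ ≤ 0 := (hmax x).trans R0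
  exact Subtype.ext (sub_eq_zero.mp (norm_le_zero_iff.mp this))

/-- Tingley's lemma: a bijective isometry between the unit spheres of two
finite-dimensional real Banach spaces is odd: `f (-x) = - f x` for all `x ∈ S_X`. -/
theorem bijective_sphere_isometry_odd
    {X : Type*} [NormedAddCommGroup X] [NormedSpace ℝ X] [FiniteDimensional ℝ X]
    {Y : Type*} [NormedAddCommGroup Y] [NormedSpace ℝ Y] [FiniteDimensional ℝ Y]
    (f : sphere (0 : X) 1 → sphere (0 : Y) 1)
    (hf_iso : Isometry f) (hf_bij : Function.Bijective f)
    (x y : sphere (0 : X) 1) (hxy : (y : X) = -(x : X)) :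
    (f y : Y) = -(f x : Y) := by
  have hd : ∀ a b, ‖(f a : Y) - f b‖ = ‖(a : X) - b‖ := by
    intro a b
    have := hf_iso.dist_eq a b
    rwa [Subtype.dist_eq, Subtype.dist_eq, dist_eq_norm, dist_eq_norm] at this
  have hs : ∀ a, ∃ b, f b = -f a := fun a => hf_bij.2 _
  choose k hk using hs
  have key := tingley_key (fun a => -k a) ?_ ?_ x
  · have hky : k x = y := by
      apply Subtype.ext
      have k2 : -(k x : X) = x := by
        rw [← coe_neg_sphere]; exact congrArg Subtype.val key
      rw [hxy, ← k2, neg_neg]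
    rw [← hky, hk]
    rfl
  · intro a b
    have e : ((-k a : sphere (0 : X) 1) : X) - (-k b : sphere (0 : X) 1) = (k b : X) - k a := by
      simp only [coe_neg_sphere]; abel
    rw [e, ← hd, hk, hk, ← hd]
    simp only [coe_neg_sphere]
    congr 1; abel
  · intro a
    have e : (a : X) + ((-k a : sphere (0 : X) 1) : X) = (a : X) - k a := by
      simp only [coe_neg_sphere]; abel
    rw [e, ← hd, hk]
    have e2 : (f a : Y) - ((-f a : sphere (0 : Y) 1) : Y) = (2 : ℝ) • (f a : Y) := by
      simp only [coe_neg_sphere]; module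
    rw [e2, norm_smul]
    simp
end

section
/- If the natural parameterization r is continuously differentiable at each point of the open interval (0, L), then the restriction of r to [0, L] is an isometry of the interval [0, L] onto the upper half-sphere Š_X endowed with the intrinsic distance; that is, đ(r(s), r(t)) = |s − t| for all s, t ∈ [0, L]. -/
open Metric Set Filter Topology

/-- Part A: polar parameterization is bi-Lipschitz-like. -/
theorem polar_facts
    {X : Type*} [NormedAddCommGroup X] [NormedSpace ℝ X]
    (hdim : Module.finrank ℝ X = 2)
    (e₁ e₂ : X) (hInd : LinearIndependent ℝ ![e₁, e₂])
    (p : ℝ → X)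
    (hp : ∀ t, p t = ‖Real.cos t • e₁ + Real.sin t • e₂‖⁻¹ •
      (Real.cos t • e₁ + Real.sin t • e₂)) :
    (∃ K : NNReal, LipschitzWith K p) ∧
    (∃ C : ℝ, ∀ t u, |Real.sin (u - t)| ≤ C * ‖p u - p t‖) ∧ p 0 ≠ p Real.pi := by
  have : FiniteDimensional ℝ X := Module.finite_of_finrank_pos (by omega)
  obtain ⟨f₁, f₂, h11, h12, h21, h22⟩ : ∃ f₁ f₂ : X →L[ℝ] ℝ,
      f₁ e₁ = 1 ∧ f₁ e₂ = 0 ∧ f₂ e₁ = 0 ∧ f₂ e₂ = 1 := by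
    let b := basisOfLinearIndependentOfCardEqFinrank hInd (by simp [hdim])
    have hb1 : b 0 = e₁ := by simp [b]
    have hb2 : b 1 = e₂ := by simp [b]
    refine ⟨LinearMap.toContinuousLinearMap (b.coord 0),
      LinearMap.toContinuousLinearMap (b.coord 1), ?_, ?_, ?_, ?_⟩ <;>
    simp [← hb1, ← hb2]
  set v : ℝ → X := fun t => Real.cos t • e₁ + Real.sin t • e₂ with hv
  have hf1 : ∀ t, f₁ (v t) = Real.cos t := by intro t; simp [hv, h11, h12]
  have hf2 : ∀ t, f₂ (v t) = Real.sin t := by intro t; simp [hv, h21, h22]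
  have hvK : ∀ s t, ‖v s - v t‖ ≤ (‖e₁‖ + ‖e₂‖) * |s - t| := by
    intro s t
    have h1 : |Real.cos s - Real.cos t| ≤ |s - t| := by
      exact Real.abs_cos_sub_cos_le s t
    have h2 : |Real.sin s - Real.sin t| ≤ |s - t| := by
      exact Real.abs_sin_sub_sin_le s t
    have : v s - v t = (Real.cos s - Real.cos t) • e₁ + (Real.sin s - Real.sin t) • e₂ := by
      simp only [hv]; module
    rw [this]
    refine (norm_add_le _ _).trans ?_
    rw [norm_smul, norm_smul, Real.norm_eq_abs, Real.norm_eq_abs]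
    nlinarith [norm_nonneg e₁, norm_nonneg e₂]
  set F := ‖f₁‖ + ‖f₂‖ with hF
  have hone : ∀ t, 1 ≤ F * ‖v t‖ := by
    intro t
    have h1 := f₁.le_opNorm (v t)
    have h2 := f₂.le_opNorm (v t)
    rw [hf1, Real.norm_eq_abs] at h1
    rw [hf2, Real.norm_eq_abs] at h2
    have : 1 ≤ |Real.cos t| + |Real.sin t| := by
      have := Real.cos_sq_add_sin_sq t
      rw [← sq_abs (Real.cos t), ← sq_abs (Real.sin t)] at this
      nlinarith [abs_nonneg (Real.cos t), abs_nonneg (Real.sin t)]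
    rw [hF, add_mul]; linarith
  have hF0 : 0 ≤ F := by positivity
  have hNpos : ∀ t, 0 < ‖v t‖ := by
    intro t
    rcases (norm_nonneg (v t)).eq_or_lt with h | h
    · have := hone t; rw [← h] at this; linarith
    · exact h
  have hNinv : ∀ t, ‖v t‖⁻¹ ≤ F := by
    intro t
    rw [inv_le_iff_one_le_mul₀ (hNpos t)]; exact hone t
  have hNle : ∀ t, ‖v t‖ ≤ ‖e₁‖ + ‖e₂‖ := by
    intro t
    refine (norm_add_le _ _).trans ?_
    rw [norm_smul, norm_smul, Real.norm_eq_abs, Real.norm_eq_abs]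
    nlinarith [norm_nonneg e₁, norm_nonneg e₂, Real.abs_cos_le_one t, Real.abs_sin_le_one t]
  have hpv : ∀ t, p t = ‖v t‖⁻¹ • v t := hp
  have hvp : ∀ t, v t = ‖v t‖ • p t := by
    intro t; rw [hpv, smul_smul, mul_inv_cancel₀ (hNpos t).ne', one_smul]
  have hpn : ∀ t, ‖p t‖ = 1 := by
    intro t; rw [hpv, norm_smul, norm_inv, norm_norm, inv_mul_cancel₀ (hNpos t).ne']
  refine ⟨⟨(2 * F * (‖e₁‖ + ‖e₂‖)).toNNReal, ?_⟩, ⟨(‖e₁‖ + ‖e₂‖) * F, ?_⟩, ?_⟩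
  · refine LipschitzWith.of_dist_le_mul fun s t => ?_
    rw [Real.coe_toNNReal _ (by positivity), dist_eq_norm, Real.dist_eq]
    have e : p s - p t = ‖v s‖⁻¹ • ((v s - v t) - (‖v s‖ - ‖v t‖) • p t) := by
      rw [sub_smul, ← hvp t, smul_sub, smul_sub, smul_sub, smul_smul,
        inv_mul_cancel₀ (hNpos s).ne', one_smul, ← hpv]
      abel
    have h1 : ‖(v s - v t) - (‖v s‖ - ‖v t‖) • p t‖ ≤ 2 * ‖v s - v t‖ := by
      refine (norm_sub_le _ _).trans ?_
      rw [norm_smul, hpn, mul_one, Real.norm_eq_abs]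
      linarith [abs_norm_sub_norm_le (v s) (v t)]
    rw [e, norm_smul, norm_inv, norm_norm]
    calc ‖v s‖⁻¹ * _ ≤ F * (2 * ((‖e₁‖ + ‖e₂‖) * |s - t|)) := by
          gcongr
          · exact hNinv s
          · exact h1.trans (by linarith [hvK s t])
      _ = _ := by ring
  · intro t u
    set φ : X →L[ℝ] ℝ := Real.cos t • f₂ - Real.sin t • f₁ with hφ
    have h0 : φ (p t) = 0 := by
      rw [hpv, map_smul]; simp [hφ, hf1, hf2]; right; ring
    have h1 : φ (v u) = Real.sin (u - t) := by
      simp [hφ, hf1, hf2, Real.sin_sub]; ring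
    have hφn : ‖φ‖ ≤ F := by
      refine (norm_sub_le _ _).trans ?_
      rw [norm_smul, norm_smul, Real.norm_eq_abs, Real.norm_eq_abs]
      nlinarith [norm_nonneg f₁, norm_nonneg f₂, Real.abs_cos_le_one t, Real.abs_sin_le_one t]
    have h2 : Real.sin (u - t) = ‖v u‖ * φ (p u - p t) := by
      rw [map_sub, h0, sub_zero, ← h1]
      conv_lhs => rw [hvp u, map_smul, smul_eq_mul]
    rw [h2, abs_mul, abs_norm, mul_assoc]
    gcongr
    · exact hNle u
    · exact (φ.le_opNorm _).trans (by gcongr)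
  · intro h
    have h' := congrArg f₁ h
    rw [hpv, hpv, map_smul, map_smul, hf1, hf1] at h'
    simp only [Real.cos_zero, Real.cos_pi, smul_eq_mul] at h'
    have := inv_pos.2 (hNpos 0); have := inv_pos.2 (hNpos Real.pi)
    linarith

/-- Part C: the chain distance of a unit speed injective curve. -/
theorem chain_dist
    {X : Type*} [NormedAddCommGroup X] [NormedSpace ℝ X]
    (r : ℝ → X) (hrc : Continuous r) (L : ℝ) (hL : 0 < L)
    (hinj : InjOn r (Icc 0 L))
    (S : Set X) (hS : S = r '' Icc 0 L)
    (d : X → X → ℝ)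
    (hd : ∀ x y : X, d x y = sSup {m : ℝ | ∃ ε > (0:ℝ), m =
      sInf {l : ℝ | ∃ (n : ℕ) (z : ℕ → X), (∀ i ≤ n, z i ∈ S) ∧ z 0 = x ∧ z n = y ∧
        (∀ i < n, ‖z (i + 1) - z i‖ < ε) ∧
        l = ∑ i ∈ Finset.range n, ‖z (i + 1) - z i‖}})
    (hC1 : ∀ s ∈ Ioo (0:ℝ) L, ContDiffAt ℝ 1 r s)
    (hunit : ∀ s ∈ Ioo (0:ℝ) L, ‖deriv r s‖ = 1) :
    ∀ s ∈ Icc (0:ℝ) L, ∀ t ∈ Icc (0:ℝ) L, d (r s) (r t) = |s - t| := by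
  have hlip : ∀ s ∈ Icc (0:ℝ) L, ∀ t ∈ Icc (0:ℝ) L, ‖r s - r t‖ ≤ |s - t| := by
    have h1 : LipschitzOnWith 1 r (Ioo 0 L) := by
      refine Convex.lipschitzOnWith_of_nnnorm_deriv_le (𝕜 := ℝ) (fun x hx => (hC1 x hx).differentiableAt (by simp))
        (fun x hx => ?_) (convex_Ioo 0 L)
      rw [← NNReal.coe_le_coe]; simp [hunit x hx]
    have h2 := (lipschitzOnWith_closure_iff hrc.continuousOn).2 h1
    rw [closure_Ioo hL.ne] at h2
    intro s hs t ht
    simpa [dist_eq_norm] using h2.dist_le_mul s hs t ht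
  -- key local-to-uniform bound
  have key : ∀ η : ℝ, 0 < η → η < 1 → η < L / 2 → ∃ ε > 0, ∀ x ∈ Icc 0 L, ∀ y ∈ Icc 0 L,
      ‖r x - r y‖ < ε →
      (1 - η) * |max η (min x (L - η)) - max η (min y (L - η))| ≤ ‖r x - r y‖ := by
    intro η h0 h1 h2
    set c : ℝ → ℝ := fun x => max η (min x (L - η)) with hc
    have hcl : ∀ x y, |c x - c y| ≤ |x - y| := by
      intro x y
      have h3 := abs_max_sub_max_le_max η (min x (L - η)) η (min y (L - η))
      have h4 := abs_min_sub_min_le_max x (L - η) y (L - η)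
      simp only [sub_self, abs_zero] at h3 h4
      exact h3.trans (max_le (abs_nonneg _) (h4.trans (max_le le_rfl (abs_nonneg _))))
    set B : Set (ℝ × ℝ) := {q | q ∈ Icc 0 L ×ˢ Icc 0 L ∧
      ‖r q.1 - r q.2‖ < (1 - η) * |c q.1 - c q.2|} with hB
    have hBsub : closure B ⊆ Icc 0 L ×ˢ Icc 0 L :=
      closure_minimal (fun q hq => hq.1) (isClosed_Icc.prod isClosed_Icc)
    have hcomp : IsCompact (closure B) :=
      (isCompact_Icc.prod isCompact_Icc).of_isClosed_subset isClosed_closure hBsub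
    have hpos : ∀ q ∈ closure B, 0 < ‖r q.1 - r q.2‖ := by
      rintro ⟨x, y⟩ hq
      rw [norm_pos_iff, sub_ne_zero]
      intro hxy
      have hI := hBsub hq
      have : x = y := hinj hI.1 hI.2 hxy
      subst this
      have hx : x ∈ Icc 0 L := hI.1
      rw [mem_closure_iff_frequently] at hq
      refine hq ?_
      by_cases hxi : x ∈ Ioo 0 L
      · have hs := (hC1 x hxi).hasStrictDerivAt (by simp)
        rw [hasStrictDerivAt_iff_hasStrictFDerivAt, hasStrictFDerivAt_iff_isLittleO] at hs
        filter_upwards [hs.bound h0] with q hq hqB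
        simp only [ContinuousLinearMap.toSpanSingleton_apply] at hq
        have hu := hunit x hxi
        have h3 : ‖(q.1 - q.2) • deriv r x‖ = |q.1 - q.2| := by
          rw [norm_smul, hu, mul_one, Real.norm_eq_abs]
        have h4 := norm_sub_norm_le ((q.1 - q.2) • deriv r x) (r q.1 - r q.2)
        rw [norm_sub_rev ((q.1 - q.2) • deriv r x), h3] at h4
        rw [Real.norm_eq_abs] at hq
        have h5 := hqB.2
        have h6 := mul_le_mul_of_nonneg_left (hcl q.1 q.2) (by linarith : 0 ≤ 1 - η)
        linarith
      · have : x = 0 ∨ x = L := by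
          by_contra hh
          push Not at hh
          exact hxi ⟨lt_of_le_of_ne hx.1 (Ne.symm hh.1), lt_of_le_of_ne hx.2 hh.2⟩
        rcases this with rfl | rfl
        · have hn : Iio η ×ˢ Iio η ∈ 𝓝 ((0:ℝ), (0:ℝ)) :=
            prod_mem_nhds (Iio_mem_nhds h0) (Iio_mem_nhds h0)
          filter_upwards [hn] with q hq hqB
          have e : ∀ z < η, c z = η := fun z hz => max_eq_left ((min_le_left _ _).trans hz.le)
          have h5 := hqB.2
          rw [e _ hq.1, e _ hq.2] at h5
          simp at h5
          exact absurd h5 (not_lt.2 (norm_nonneg _))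
        · have hn : Ioi (x - η) ×ˢ Ioi (x - η) ∈ 𝓝 (x, x) :=
            prod_mem_nhds (Ioi_mem_nhds (by linarith)) (Ioi_mem_nhds (by linarith))
          filter_upwards [hn] with q hq hqB
          have e : ∀ z > x - η, c z = max η (x - η) := fun z hz => by
            simp only [hc]; rw [min_eq_right (le_of_lt hz)]
          have h5 := hqB.2
          rw [e _ hq.1, e _ hq.2] at h5
          simp at h5
          exact absurd h5 (not_lt.2 (norm_nonneg _))
    rcases (closure B).eq_empty_or_nonempty with he | hne
    · refine ⟨1, one_pos, fun x hx y hy _ => ?_⟩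
      by_contra hh
      have : (x, y) ∈ closure B := subset_closure ⟨⟨hx, hy⟩, not_le.1 hh⟩
      rw [he] at this; exact this
    · obtain ⟨q, hq, hmin⟩ := hcomp.exists_isMinOn hne
        (f := fun q : ℝ × ℝ => ‖r q.1 - r q.2‖) (by fun_prop)
      refine ⟨_, hpos q hq, fun x hx y hy hlt => ?_⟩
      by_contra hh
      have : (x, y) ∈ closure B := subset_closure ⟨⟨hx, hy⟩, not_le.1 hh⟩
      exact absurd (hmin this) (not_le.2 hlt)
  intro s hs t ht
  rw [hd]
  set A : ℝ → Set ℝ := fun ε => {l : ℝ | ∃ (n : ℕ) (z : ℕ → X), (∀ i ≤ n, z i ∈ S) ∧ z 0 = r s ∧ z n = r t ∧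
        (∀ i < n, ‖z (i + 1) - z i‖ < ε) ∧
        l = ∑ i ∈ Finset.range n, ‖z (i + 1) - z i‖} with hA
  have hbdd : ∀ ε, BddBelow (A ε) := by
    intro ε
    refine ⟨0, ?_⟩
    rintro l ⟨n, z, -, -, -, -, rfl⟩
    positivity
  have hmem : ∀ ε > 0, ∃ l ∈ A ε, l ≤ |s - t| := by
    intro ε hε
    obtain ⟨n, hn⟩ := exists_nat_gt (|s - t| / ε)
    have hn0 : (0:ℝ) < n := lt_of_le_of_lt (by positivity) hn
    have hstep : |s - t| / n < ε := by
      rw [div_lt_iff₀ hε] at hn; rw [div_lt_iff₀ hn0]; linarith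
    let w : ℕ → ℝ := fun i => s + (i / n : ℝ) * (t - s)
    have hw : ∀ i ≤ n, w i ∈ Icc 0 L := by
      intro i hi
      have h1 : (i / n : ℝ) ≤ 1 := by
        rw [div_le_one hn0]; exact_mod_cast hi
      have h2 : (0:ℝ) ≤ i / n := by positivity
      have := (convex_Icc 0 L).add_smul_sub_mem hs ht ⟨h2, h1⟩
      simpa [w] using this
    have hww : ∀ i, |w (i + 1) - w i| = |s - t| / n := by
      intro i
      have : w (i + 1) - w i = (t - s) / n := by
        simp only [w]; push_cast; field_simp; ring
      rw [this, abs_div, abs_sub_comm, abs_of_pos hn0]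
    have hb : ∀ i < n, ‖r (w (i + 1)) - r (w i)‖ ≤ |s - t| / n := by
      intro i hi
      rw [← hww i]
      exact hlip _ (hw _ hi) _ (hw _ hi.le)
    refine ⟨_, ⟨n, fun i => r (w i), ?_, ?_, ?_, ?_, rfl⟩, ?_⟩
    · intro i hi; rw [hS]; exact mem_image_of_mem _ (hw i hi)
    · simp [w]
    · simp [w, div_self hn0.ne']
    · intro i hi; exact (hb i hi).trans_lt hstep
    · calc _ ≤ ∑ i ∈ Finset.range n, |s - t| / n :=
            Finset.sum_le_sum fun i hi => hb i (Finset.mem_range.1 hi)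
        _ = |s - t| := by simp; field_simp
  have hup : ∀ m ∈ {m : ℝ | ∃ ε > (0:ℝ), m = sInf (A ε)}, m ≤ |s - t| := by
    rintro m ⟨ε, hε, rfl⟩
    obtain ⟨l, hl, hle⟩ := hmem ε hε
    exact (csInf_le (hbdd ε) hl).trans hle
  refine le_antisymm (csSup_le ⟨_, 1, one_pos, rfl⟩ hup) ?_
  have hlow : ∀ η : ℝ, 0 < η → η < 1 → η < L / 2 → (1 - η) * (|s - t| - 2 * η) ≤
      sSup {m : ℝ | ∃ ε > (0:ℝ), m = sInf (A ε)} := by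
    intro η h0 h1 h2
    obtain ⟨ε, hε, hk⟩ := key η h0 h1 h2
    refine le_trans ?_ (le_csSup ⟨_, hup⟩ ⟨ε, hε, rfl⟩)
    obtain ⟨l0, hl0, -⟩ := hmem ε hε
    refine le_csInf ⟨l0, hl0⟩ ?_
    rintro l ⟨n, z, hzS, hz0, hzn, hze, rfl⟩
    have hex : ∀ i, ∃ w, i ≤ n → w ∈ Icc 0 L ∧ r w = z i := by
      intro i
      by_cases hi : i ≤ n
      · have := hzS i hi
        rw [hS] at this
        obtain ⟨w, hw, e⟩ := this
        exact ⟨w, fun _ => ⟨hw, e⟩⟩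
      · exact ⟨0, fun h => absurd h hi⟩
    choose w hw using hex
    set c : ℝ → ℝ := fun x => max η (min x (L - η)) with hc
    have hw0 : w 0 = s := hinj (hw 0 (Nat.zero_le _)).1 hs ((hw 0 (Nat.zero_le _)).2.trans hz0)
    have hwn : w n = t := hinj (hw n le_rfl).1 ht ((hw n le_rfl).2.trans hzn)
    have hcc : ∀ x ∈ Icc 0 L, |c x - x| ≤ η := by
      intro x hx
      simp only [hc]
      rw [abs_le]
      rcases le_total x (L - η) with h | h
      · rw [min_eq_left h]
        rcases le_total η x with h' | h'
        · rw [max_eq_right h']; constructor <;> linarith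
        · rw [max_eq_left h']; constructor <;> linarith [hx.1]
      · rw [min_eq_right h, max_eq_right (by linarith)]; constructor <;> linarith [hx.2]
    have h3 : |s - t| - 2 * η ≤ |c s - c t| := by
      have a1 := hcc s hs
      have a2 := hcc t ht
      have : s - t = (c s - c t) - (c s - s) + (c t - t) := by ring
      have a3 := abs_add_le ((c s - c t) - (c s - s)) (c t - t)
      have a4 := abs_sub (c s - c t) (c s - s)
      rw [← this] at a3
      linarith
    have h4 : |c s - c t| ≤ ∑ i ∈ Finset.range n, |c (w (i + 1)) - c (w i)| := by
      have := dist_le_range_sum_dist (fun i => c (w i)) n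
      simp only [hw0, hwn, Real.dist_eq] at this
      refine this.trans (le_of_eq (Finset.sum_congr rfl fun i _ => abs_sub_comm _ _))
    calc (1 - η) * (|s - t| - 2 * η)
        ≤ (1 - η) * ∑ i ∈ Finset.range n, |c (w (i + 1)) - c (w i)| :=
          mul_le_mul_of_nonneg_left (h3.trans h4) (by linarith)
      _ = ∑ i ∈ Finset.range n, (1 - η) * |c (w (i + 1)) - c (w i)| := Finset.mul_sum _ _ _
      _ ≤ _ := by
        refine Finset.sum_le_sum fun i hi => ?_
        have hi := Finset.mem_range.1 hi
        have b1 := hw (i + 1) hi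
        have b2 := hw i hi.le
        have := hk _ b1.1 _ b2.1
        rw [b1.2, b2.2] at this
        exact this (hze i hi)
  have hev : ∀ᶠ η in 𝓝[>] (0:ℝ), (1 - η) * (|s - t| - 2 * η) ≤
      sSup {m : ℝ | ∃ ε > (0:ℝ), m = sInf (A ε)} := by
    have : Ioo (0:ℝ) (min 1 (L / 2)) ∈ 𝓝[>] (0:ℝ) :=
      Ioo_mem_nhdsGT (lt_min one_pos (by linarith))
    filter_upwards [this] with η hη
    exact hlow η hη.1 (hη.2.trans_le (min_le_left _ _)) (hη.2.trans_le (min_le_right _ _))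
  have hlim : Tendsto (fun η : ℝ => (1 - η) * (|s - t| - 2 * η)) (𝓝[>] 0) (𝓝 |s - t|) := by
    have : Continuous (fun η : ℝ => (1 - η) * (|s - t| - 2 * η)) := by fun_prop
    have h := this.tendsto 0
    simp only [sub_zero, mul_zero, one_mul] at h
    exact h.mono_left nhdsWithin_le_nhds
  exact le_of_tendsto hlim hev

theorem natural_parameterization_intrinsic_isometry
    {X : Type*} [NormedAddCommGroup X] [NormedSpace ℝ X] [CompleteSpace X]
    (hdim : Module.finrank ℝ X = 2)
    (e₁ e₂ : X) (hInd : LinearIndependent ℝ ![e₁, e₂])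
    (p : ℝ → X)
    (hp : ∀ t, p t = ‖Real.cos t • e₁ + Real.sin t • e₂‖⁻¹ •
      (Real.cos t • e₁ + Real.sin t • e₂))
    (σ : ℝ → ℝ) (hσ : ∀ t, σ t = ∫ u in (0:ℝ)..t, ‖derivWithin p (Ici u) u‖)
    (τ : ℝ → ℝ) (hτ_cont : Continuous τ) (hτ_mono : StrictMono τ)
    (hστ : ∀ x, σ (τ x) = x)
    (r : ℝ → X) (hr : ∀ s, r s = p (τ s))
    (L : ℝ) (hL : L = σ Real.pi)
    -- the upper half-sphere
    (S : Set X) (hS : S = r '' Icc 0 L)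
    -- the intrinsic distance on the upper half-sphere
    (d : X → X → ℝ)
    (hd : ∀ x y : X, d x y = sSup {m : ℝ | ∃ ε > (0:ℝ), m =
      sInf {l : ℝ | ∃ (n : ℕ) (z : ℕ → X), (∀ i ≤ n, z i ∈ S) ∧ z 0 = x ∧ z n = y ∧
        (∀ i < n, ‖z (i + 1) - z i‖ < ε) ∧
        l = ∑ i ∈ Finset.range n, ‖z (i + 1) - z i‖}})
    -- `r` is continuously differentiable at each point of `(0, L)`
    (hC1 : ∀ s ∈ Ioo (0:ℝ) L, ContDiffAt ℝ 1 r s) :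
    ∀ s ∈ Icc (0:ℝ) L, ∀ t ∈ Icc (0:ℝ) L, d (r s) (r t) = |s - t| := by
  have : FiniteDimensional ℝ X := Module.finite_of_finrank_pos (by omega)
  obtain ⟨⟨K, hK⟩, ⟨C, hC⟩, hne⟩ := polar_facts hdim e₁ e₂ hInd p hp
  have hdiff : ∀ᵐ t, DifferentiableAt ℝ p t := hK.ae_differentiableAt_real
  have hdw : ∀ t, DifferentiableAt ℝ p t → derivWithin p (Ici t) t = deriv p t :=
    fun t ht => ht.derivWithin (uniqueDiffWithinAt_Ici t)
  have hderiv_ne : ∀ t, DifferentiableAt ℝ p t → deriv p t ≠ 0 := by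
    intro t ht h0
    have h1 := ht.hasDerivAt
    rw [h0, hasDerivAt_iff_isLittleO] at h1
    simp only [smul_zero, sub_zero] at h1
    have h2 : (fun u => Real.sin (u - t)) =O[𝓝 t] (fun u => p u - p t) :=
      Asymptotics.IsBigO.of_bound C (Eventually.of_forall fun u => hC t u)
    have h3 := h2.trans_isLittleO h1
    have h4 : HasDerivAt (fun u => Real.sin (u - t)) 0 t := by
      rw [hasDerivAt_iff_isLittleO]; simpa using h3
    have h5 : HasDerivAt (fun u => Real.sin (u - t)) 1 t := by
      simpa using ((hasDerivAt_id t).sub_const t).sin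
    exact zero_ne_one (h4.unique h5)
  set g : ℝ → ℝ := fun u => ‖derivWithin p (Ici u) u‖ with hg
  have hgpos : ∀ᵐ t, 0 < g t := by
    filter_upwards [hdiff] with t ht
    simp only [hg, hdw t ht]
    exact norm_pos_iff.2 (hderiv_ne t ht)
  have hgloc : MeasureTheory.LocallyIntegrable g MeasureTheory.volume := by
    have hc : MeasureTheory.LocallyIntegrable (fun _ : ℝ => (K : ℝ)) MeasureTheory.volume :=
      MeasureTheory.locallyIntegrable_const _
    refine hc.mono ?_ ?_
    · borelize X
      exact (measurable_derivWithin_Ici p).norm.aestronglyMeasurable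
    · filter_upwards [hdiff] with t ht
      simp only [hg, hdw t ht, norm_norm]
      exact (norm_deriv_le_of_lipschitz hK).trans (le_abs_self _)
  have hgint : ∀ a b, IntervalIntegrable g MeasureTheory.volume a b := fun a b =>
    intervalIntegrable_iff.mpr <|
      (hgloc.integrableOn_isCompact isCompact_uIcc).mono_set uIoc_subset_uIcc
  have hσmono : StrictMono σ := by
    intro a b hab
    have h1 : σ b - σ a = ∫ u in a..b, g u := by
      rw [hσ, hσ]; exact intervalIntegral.integral_interval_sub_left (hgint _ _) (hgint _ _)
    have h2 : 0 < ∫ u in a..b, g u := by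
      rw [intervalIntegral.integral_pos_iff_support_of_nonneg_ae
        (Eventually.of_forall fun u => norm_nonneg _) (hgint a b)]
      refine ⟨hab, ?_⟩
      have : MeasureTheory.volume (Function.support g ∩ Ioc a b) = MeasureTheory.volume (Ioc a b) := by
        refine MeasureTheory.measure_congr ?_
        filter_upwards [hgpos] with u hu
        have hu' : u ∈ Function.support g := hu.ne'
        exact propext ⟨fun h => h.2, fun h => ⟨hu', h⟩⟩
      rw [this]; simp [hab]
    linarith
  have hτσ : ∀ u, τ (σ u) = u := fun u => hσmono.injective (hστ _)
  have hσ0 : σ 0 = 0 := by rw [hσ]; simp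
  have hLpos : 0 < L := by rw [hL, ← hσ0]; exact hσmono Real.pi_pos
  have hτ0 : τ 0 = 0 := by have := hτσ 0; rwa [hσ0] at this
  have hτL : τ L = Real.pi := by rw [hL, hτσ]
  have hpr : ∀ u, p u = r (σ u) := fun u => by rw [hr, hτσ]
  have hrc : Continuous r := by
    have : r = p ∘ τ := funext hr
    rw [this]; exact hK.continuous.comp hτ_cont
  have hσc : Continuous σ := by
    have : σ = fun t => ∫ u in (0:ℝ)..t, g u := funext hσ
    rw [this]; exact intervalIntegral.continuous_primitive hgint 0
  have hinj : InjOn r (Icc 0 L) := by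
    have main : ∀ x ∈ Icc 0 L, ∀ y ∈ Icc 0 L, x < y → r x ≠ r y := by
      intro x hx y hy hlt he
      rw [hr, hr] at he
      have h1 := hτ_mono hlt
      have h2 : 0 ≤ τ x := by rw [← hτ0]; exact hτ_mono.monotone hx.1
      have h3 : τ y ≤ Real.pi := by rw [← hτL]; exact hτ_mono.monotone hy.2
      have h4 := hC (τ x) (τ y)
      rw [he, sub_self, norm_zero, mul_zero] at h4
      have h5 : Real.sin (τ y - τ x) = 0 := abs_nonpos_iff.1 h4
      have h6 : τ y - τ x = Real.pi := by
        by_contra hh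
        have : τ y - τ x < Real.pi := lt_of_le_of_ne (by linarith) hh
        exact (Real.sin_pos_of_pos_of_lt_pi (by linarith) this).ne' h5
      have h7 : τ x = 0 := by linarith
      have h8 : τ y = Real.pi := by linarith
      rw [h7, h8] at he
      exact hne he
    intro x hx y hy he
    rcases lt_trichotomy x y with h | h | h
    · exact absurd he (main x hx y hy h)
    · exact h
    · exact absurd he.symm (main y hy x hx h)
  have hgood : ∀ᵐ t, σ t ∈ Ioo 0 L → ‖deriv r (σ t)‖ = 1 := by
    filter_upwards [hdiff, hgpos, LocallyIntegrable.ae_hasDerivAt_integral hgloc] with t ht hpos hder hmem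
    have h1 : HasDerivAt σ (g t) t := by
      have : σ = fun t => ∫ u in (0:ℝ)..t, g u := funext hσ
      rw [this]; exact hder 0
    have h2 : HasDerivAt r (deriv r (σ t)) (σ t) :=
      ((hC1 _ hmem).differentiableAt (by simp)).hasDerivAt
    have h3 : HasDerivAt p (g t • deriv r (σ t)) t := by
      have := h2.scomp t h1
      have e : r ∘ σ = p := funext fun u => (hpr u).symm
      rwa [e] at this
    have h4 := congrArg norm h3.deriv
    rw [norm_smul, Real.norm_eq_abs, abs_of_pos hpos] at h4
    have h5 : g t = ‖deriv p t‖ := by simp only [hg, hdw t ht]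
    rw [← h5] at h4
    exact mul_left_cancel₀ hpos.ne' (by rw [mul_one]; exact h4.symm)
  have hunit : ∀ s ∈ Ioo (0:ℝ) L, ‖deriv r s‖ = 1 := by
    intro s hs
    by_contra hh
    have hcont : ContinuousAt (fun s => ‖deriv r s‖) s := by
      have h1 := (hC1 s hs).continuousAt_fderiv (by simp)
      have h2 : deriv r = fun s => fderiv ℝ r s 1 := by
        funext u; exact fderiv_apply_one_eq_deriv.symm
      rw [h2]
      exact (h1.clm_apply continuousAt_const).norm
    have hev : ∀ᶠ s' in 𝓝 s, ‖deriv r s'‖ ≠ 1 ∧ s' ∈ Ioo 0 L :=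
      (hcont.eventually_ne hh).and (isOpen_Ioo.mem_nhds hs)
    have hev2 : ∀ᶠ t in 𝓝 (τ s), ‖deriv r (σ t)‖ ≠ 1 ∧ σ t ∈ Ioo 0 L := by
      have := hσc.tendsto (τ s)
      rw [hστ] at this
      exact this.eventually hev
    have hdense := MeasureTheory.Measure.dense_of_ae hgood
    obtain ⟨t, ht1, ht2⟩ := mem_closure_iff_nhds.1 (hdense (τ s)) _ hev2
    exact ht1.1 (ht2 ht1.2)
  exact chain_dist r hrc L hLpos hinj S hS d hd hC1 hunit
end

section
/- For every s ∈ ℝ, the natural parameterization satisfies ‖r(s+ε) − r(s)‖ = (1 + o(1))·|ε| as ε → 0; that is, lim_{ε→0, ε≠0} ‖r(s+ε) − r(s)‖/|ε| = 1. -/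
open Metric Set Filter Topology MeasureTheory

lemma aux_convex_right {f : ℝ → ℝ} (hf : ConvexOn ℝ univ f) (hc : Continuous f) :
    Tendsto (fun x => derivWithin f (Ioi x) x) (𝓝[>] 0) (𝓝 (derivWithin f (Ioi 0) 0)) := by
  have hint : ∀ x : ℝ, x ∈ interior (univ : Set ℝ) := fun x => by simp
  rw [tendsto_order]
  constructor
  · intro c hcl
    filter_upwards [self_mem_nhdsWithin] with x hx
    exact hcl.trans_le (hf.monotoneOn_rightDeriv (hint _) (hint _) (le_of_lt hx))
  · intro c hcl
    have h1 := hf.hasDerivWithinAt_rightDeriv_of_mem_interior (hint 0)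
    rw [hasDerivWithinAt_iff_tendsto_slope' (by simp)] at h1
    obtain ⟨y, hy, hy0⟩ := ((h1.eventually_lt_const hcl).and self_mem_nhdsWithin).exists
    have hy0' : (0:ℝ) < y := hy0
    have h2 : Tendsto (fun x => slope f x y) (𝓝[>] 0) (𝓝 (slope f 0 y)) := by
      refine Tendsto.mono_left ?_ nhdsWithin_le_nhds
      have : ContinuousAt (fun x => (f y - f x) / (y - x)) 0 := by
        apply ContinuousAt.div
        · fun_prop
        · fun_prop
        · simpa using hy0'.ne'
      simpa only [slope_def_field, ContinuousAt] using this
    filter_upwards [h2.eventually_lt_const hy, Ioo_mem_nhdsGT hy0'] with x hx hxy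
    exact (hf.rightDeriv_le_slope_of_mem_interior (hint _) (mem_univ y) hxy.2).trans_lt hx

lemma aux_convex_left {f : ℝ → ℝ} (hf : ConvexOn ℝ univ f) (hc : Continuous f) :
    Tendsto (fun x => derivWithin f (Ioi x) x) (𝓝[<] 0) (𝓝 (derivWithin f (Iio 0) 0)) := by
  have hint : ∀ x : ℝ, x ∈ interior (univ : Set ℝ) := fun x => by simp
  rw [tendsto_order]
  constructor
  · intro c hcl
    have h1 := hf.hasDerivWithinAt_leftDeriv_of_mem_interior (hint 0)
    rw [hasDerivWithinAt_iff_tendsto_slope' (by simp)] at h1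
    obtain ⟨y, hy, hy0⟩ := ((h1.eventually_const_lt hcl).and self_mem_nhdsWithin).exists
    have hy0' : y < (0:ℝ) := hy0
    have h2 : Tendsto (fun x => slope f y x) (𝓝[<] 0) (𝓝 (slope f y 0)) := by
      refine Tendsto.mono_left ?_ nhdsWithin_le_nhds
      have : ContinuousAt (fun x => (f x - f y) / (x - y)) 0 := by
        apply ContinuousAt.div
        · fun_prop
        · fun_prop
        · simpa using hy0'.ne
      simpa only [slope_def_field, ContinuousAt] using this
    rw [slope_comm] at hy
    filter_upwards [h2.eventually_const_lt hy, Ioo_mem_nhdsLT hy0'] with x hx hxy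
    exact hx.trans_le ((hf.slope_le_leftDeriv_of_mem_interior (mem_univ y) (hint _) hxy.1).trans
      (hf.leftDeriv_le_rightDeriv_of_mem_interior (hint _)))
  · intro c hcl
    filter_upwards [self_mem_nhdsWithin] with x hx
    exact ((hf.rightDeriv_le_slope_of_mem_interior (hint _) (mem_univ 0) hx).trans
      (hf.slope_le_leftDeriv_of_mem_interior (mem_univ x) (hint _) hx)).trans_lt hcl

lemma aux_q {X : Type*} [NormedAddCommGroup X] [NormedSpace ℝ X] (a b : X) (x D : ℝ) (s : Set ℝ)
    (hpos : a + x • b ≠ 0)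
    (h : HasDerivWithinAt (fun y : ℝ => ‖a + y • b‖) D s x) :
    HasDerivWithinAt (fun y : ℝ => ‖a + y • b‖⁻¹ • (a + y • b))
      (‖a + x • b‖⁻¹ • b + (-D / ‖a + x • b‖ ^ 2) • (a + x • b)) s x := by
  have h1 : HasDerivWithinAt (fun y : ℝ => a + y • b) b s x := by
    simpa using ((hasDerivWithinAt_id x s).smul_const b).const_add a
  exact (h.inv (norm_ne_zero_iff.2 hpos)).smul h1

lemma aux_tan {X : Type*} [NormedAddCommGroup X] [NormedSpace ℝ X] (p q : ℝ → X) (t : ℝ)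
    (hpq : ∀ u, |u - t| < Real.pi / 2 → p u = q (Real.tan (u - t)))
    (u : ℝ) (hu : |u - t| < Real.pi / 2) (d : X) :
    (HasDerivWithinAt q d (Ioi (Real.tan (u - t))) (Real.tan (u - t)) →
      HasDerivWithinAt p ((1 / Real.cos (u - t) ^ 2) • d) (Ici u) u) ∧
    (HasDerivWithinAt q d (Iio (Real.tan (u - t))) (Real.tan (u - t)) →
      HasDerivWithinAt p ((1 / Real.cos (u - t) ^ 2) • d) (Iic u) u) := by
  have hu' := abs_lt.1 hu
  have hcos : Real.cos (u - t) ≠ 0 := (Real.cos_pos_of_mem_Ioo ⟨hu'.1, hu'.2⟩).ne'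
  have ht : HasDerivAt (fun v => Real.tan (v - t)) (1 / Real.cos (u - t) ^ 2) u := by
    simpa using (Real.hasDerivAt_tan hcos).comp_sub_const u t
  have hopen : {v : ℝ | |v - t| < Real.pi / 2} ∈ 𝓝 u :=
    (isOpen_lt (by fun_prop) (by fun_prop)).mem_nhds hu
  constructor
  · intro h
    have h' := h.Ici_of_Ioi
    have h2 : HasDerivWithinAt p ((1 / Real.cos (u - t) ^ 2) • d)
        (Ici u ∩ {v : ℝ | |v - t| < Real.pi / 2}) u := by
      refine HasDerivWithinAt.congr (f := q ∘ fun v => Real.tan (v - t)) ?_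
        (fun v hv => hpq v hv.2) (hpq u hu)
      refine HasDerivWithinAt.scomp u h' ht.hasDerivWithinAt ?_
      rintro v ⟨hv, hv2⟩
      have hv3 : |v - t| < Real.pi / 2 := hv2
      have hv' := abs_lt.1 hv3
      exact Real.strictMonoOn_tan.monotoneOn ⟨hu'.1, hu'.2⟩ ⟨hv'.1, hv'.2⟩
        (sub_le_sub_right hv t)
    exact (hasDerivWithinAt_inter hopen).1 h2
  · intro h
    have h' := h.Iic_of_Iio
    have h2 : HasDerivWithinAt p ((1 / Real.cos (u - t) ^ 2) • d)
        (Iic u ∩ {v : ℝ | |v - t| < Real.pi / 2}) u := by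
      refine HasDerivWithinAt.congr (f := q ∘ fun v => Real.tan (v - t)) ?_
        (fun v hv => hpq v hv.2) (hpq u hu)
      refine HasDerivWithinAt.scomp u h' ht.hasDerivWithinAt ?_
      rintro v ⟨hv, hv2⟩
      have hv3 : |v - t| < Real.pi / 2 := hv2
      have hv' := abs_lt.1 hv3
      exact Real.strictMonoOn_tan.monotoneOn ⟨hv'.1, hv'.2⟩ ⟨hu'.1, hu'.2⟩
        (sub_le_sub_right hv t)
    exact (hasDerivWithinAt_inter hopen).1 h2

lemma aux_p {X : Type*} [NormedAddCommGroup X] [NormedSpace ℝ X]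
    (e₁ e₂ : X) (hInd : LinearIndependent ℝ ![e₁, e₂])
    (p : ℝ → X)
    (hp : ∀ t, p t = ‖Real.cos t • e₁ + Real.sin t • e₂‖⁻¹ •
      (Real.cos t • e₁ + Real.sin t • e₂)) (t : ℝ) :
    (∃ d : X, d ≠ 0 ∧ HasDerivWithinAt p d (Ici t) t ∧
      Tendsto (fun u => derivWithin p (Ici u) u) (𝓝[>] t) (𝓝 d)) ∧
    (∃ d : X, d ≠ 0 ∧ HasDerivWithinAt p d (Iic t) t ∧
      Tendsto (fun u => derivWithin p (Ici u) u) (𝓝[<] t) (𝓝 d)) := by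
  set a : X := Real.cos t • e₁ + Real.sin t • e₂ with ha
  set b : X := (-Real.sin t) • e₁ + Real.cos t • e₂ with hb
  have hab : ∀ α β : ℝ, α • a + β • b = 0 → α = 0 ∧ β = 0 := by
    intro α β h
    have h1 : (α * Real.cos t - β * Real.sin t) • e₁ + (α * Real.sin t + β * Real.cos t) • e₂ = 0 := by
      rw [← h, ha, hb]; module
    obtain ⟨h2, h3⟩ := LinearIndependent.pair_iff.1 hInd _ _ h1
    have h4 := Real.sin_sq_add_cos_sq t
    constructor
    · linear_combination Real.cos t * h2 + Real.sin t * h3 - α * h4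
    · linear_combination -Real.sin t * h2 + Real.cos t * h3 - β * h4
  have hne : ∀ x : ℝ, a + x • b ≠ 0 := by
    intro x h
    have := (hab 1 x (by simpa using h)).1
    norm_num at this
  set f : ℝ → ℝ := fun x => ‖a + x • b‖ with hf
  have hfc : Continuous f := by fun_prop
  have hconv : ConvexOn ℝ univ f := by
    have h1 : ConvexOn ℝ univ (norm : X → ℝ) := convexOn_norm convex_univ
    have h2 := h1.comp_affineMap (AffineMap.lineMap a (a + b) : ℝ →ᵃ[ℝ] X)
    have h3 : (norm : X → ℝ) ∘ (AffineMap.lineMap a (a + b) : ℝ →ᵃ[ℝ] X) = f := by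
      ext x
      simp [AffineMap.lineMap_apply, hf, add_comm]
    simpa [h3] using h2
  have hint : ∀ x : ℝ, x ∈ interior (univ : Set ℝ) := fun x => by simp
  set q : ℝ → X := fun y => ‖a + y • b‖⁻¹ • (a + y • b) with hq
  have hpq : ∀ u, |u - t| < Real.pi / 2 → p u = q (Real.tan (u - t)) := by
    intro u hu
    have hu' := abs_lt.1 hu
    have hcos : 0 < Real.cos (u - t) := Real.cos_pos_of_mem_Ioo ⟨hu'.1, hu'.2⟩
    have h1 : Real.cos u • e₁ + Real.sin u • e₂
        = Real.cos (u - t) • (a + Real.tan (u - t) • b) := by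
      have e : u = (u - t) + t := by ring
      rw [smul_add, smul_smul, mul_comm, Real.tan_mul_cos hcos.ne', ha, hb]
      conv_lhs => rw [e, Real.cos_add, Real.sin_add]
      module
    rw [hp, h1, hq, norm_smul, Real.norm_of_nonneg hcos.le, smul_smul]
    congr 1
    field_simp
  set Q : ℝ → ℝ → X := fun x D => ‖a + x • b‖⁻¹ • b + (-D / ‖a + x • b‖ ^ 2) • (a + x • b) with hQ
  have hQ0 : ∀ D, Q 0 D ≠ 0 := by
    intro D h
    have h1 := (hab (-D / ‖a‖ ^ 2) (‖a‖⁻¹) (by rw [← h, hQ]; simp [add_comm])).2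
    have := hne 0
    simp at this h1
    exact this h1
  have hQc : ∀ (l : Filter ℝ) (D : ℝ → ℝ) (D0 : ℝ), l ≤ 𝓝 0 → Tendsto D l (𝓝 D0) →
      Tendsto (fun x => Q x (D x)) l (𝓝 (Q 0 D0)) := by
    intro l D D0 hl hD
    have hx : Tendsto (fun x : ℝ => x) l (𝓝 0) := hl
    have h1 : Tendsto (fun x : ℝ => a + x • b) l (𝓝 (a + (0:ℝ) • b)) :=
      (hx.smul_const b).const_add a
    have h2 := h1.norm
    have hn : ‖a + (0:ℝ) • b‖ ≠ 0 := norm_ne_zero_iff.2 (hne 0)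
    exact ((h2.inv₀ hn).smul_const b).add ((hD.neg.div (h2.pow 2) (pow_ne_zero 2 hn)).smul h1)
  have htt : |t - t| < Real.pi / 2 := by simpa using Real.pi_div_two_pos
  have hdR : ∀ u, |u - t| < Real.pi / 2 → HasDerivWithinAt p ((1 / Real.cos (u - t) ^ 2) •
      Q (Real.tan (u - t)) (derivWithin f (Ioi (Real.tan (u - t))) (Real.tan (u - t)))) (Ici u) u := by
    intro u hu
    exact (aux_tan p q t hpq u hu _).1 (aux_q a b _ _ _ (hne _)
      (hconv.hasDerivWithinAt_rightDeriv_of_mem_interior (hint _)))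
  have hdL : HasDerivWithinAt p ((1 / Real.cos (t - t) ^ 2) •
      Q (Real.tan (t - t)) (derivWithin f (Iio (Real.tan (t - t))) (Real.tan (t - t)))) (Iic t) t := by
    exact (aux_tan p q t hpq t htt _).2 (aux_q a b _ _ _ (hne _)
      (hconv.hasDerivWithinAt_leftDeriv_of_mem_interior (hint _)))
  have hopen : {v : ℝ | |v - t| < Real.pi / 2} ∈ 𝓝 t :=
    (isOpen_lt (by fun_prop) (by fun_prop)).mem_nhds htt
  have hev : ∀ᶠ u in 𝓝 t, (1 / Real.cos (u - t) ^ 2) •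
      Q (Real.tan (u - t)) (derivWithin f (Ioi (Real.tan (u - t))) (Real.tan (u - t)))
      = derivWithin p (Ici u) u := by
    filter_upwards [hopen] with u hu
    exact ((hdR u hu).derivWithin (uniqueDiffWithinAt_Ici u)).symm
  have hcosT : Tendsto (fun u => 1 / Real.cos (u - t) ^ 2) (𝓝 t) (𝓝 1) := by
    have : ContinuousAt (fun u => 1 / Real.cos (u - t) ^ 2) t := by
      apply ContinuousAt.div
      · fun_prop
      · fun_prop
      · simp
    simpa [ContinuousAt] using this
  have htanT : Tendsto (fun u => Real.tan (u - t)) (𝓝 t) (𝓝 0) := by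
    have h1 : HasDerivAt (fun v => Real.tan (v - t)) (1 / Real.cos (t - t) ^ 2) t := by
      simpa using (Real.hasDerivAt_tan (x := t - t) (by simp)).comp_sub_const t t
    simpa [ContinuousAt] using h1.continuousAt
  have hR := hdR t htt
  simp only [sub_self, Real.tan_zero, Real.cos_zero, one_pow, div_one, one_smul] at hR hdL
  refine ⟨⟨_, hQ0 _, hR, ?_⟩, ⟨_, hQ0 _, hdL, ?_⟩⟩
  · have h1 : Tendsto (fun u => Real.tan (u - t)) (𝓝[>] t) (𝓝[>] 0) := by
      rw [tendsto_nhdsWithin_iff]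
      refine ⟨htanT.mono_left nhdsWithin_le_nhds, ?_⟩
      filter_upwards [self_mem_nhdsWithin, nhdsWithin_le_nhds hopen] with u hu hu2
      exact Real.tan_pos_of_pos_of_lt_pi_div_two (sub_pos.2 hu) (abs_lt.1 hu2).2
    have h2 := (hcosT.mono_left nhdsWithin_le_nhds).smul
      ((hQc _ _ _ nhdsWithin_le_nhds (aux_convex_right hconv hfc)).comp h1)
    rw [one_smul] at h2
    exact h2.congr' (hev.filter_mono nhdsWithin_le_nhds)
  · have h1 : Tendsto (fun u => Real.tan (u - t)) (𝓝[<] t) (𝓝[<] 0) := by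
      rw [tendsto_nhdsWithin_iff]
      refine ⟨htanT.mono_left nhdsWithin_le_nhds, ?_⟩
      filter_upwards [self_mem_nhdsWithin, nhdsWithin_le_nhds hopen] with u hu hu2
      exact Real.tan_neg_of_neg_of_pi_div_two_lt (sub_neg.2 hu) (abs_lt.1 hu2).1
    have h2 := (hcosT.mono_left nhdsWithin_le_nhds).smul
      ((hQc _ _ _ nhdsWithin_le_nhds (aux_convex_left hconv hfc)).comp h1)
    rw [one_smul] at h2
    exact h2.congr' (hev.filter_mono nhdsWithin_le_nhds)

lemma aux_ratio {X : Type*} [NormedAddCommGroup X] [NormedSpace ℝ X] (p : ℝ → X) (σ : ℝ → ℝ)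
    (t : ℝ) (s : Set ℝ) (d : X) (hd : d ≠ 0) (hp : HasDerivWithinAt p d s t)
    (hσ : HasDerivWithinAt σ ‖d‖ s t) :
    Tendsto (fun v => ‖p v - p t‖ / |σ v - σ t|) (𝓝[s \ {t}] t) (𝓝 1) := by
  rw [hasDerivWithinAt_iff_tendsto_slope] at hp hσ
  have hn : ‖d‖ ≠ 0 := norm_ne_zero_iff.2 hd
  have h := hp.norm.div hσ.abs (by simpa using hn)
  rw [abs_norm, div_self hn] at h
  refine h.congr' ?_
  filter_upwards [self_mem_nhdsWithin] with v hv
  have hv0 : |v - t| ≠ 0 := abs_ne_zero.2 (sub_ne_zero.2 hv.2)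
  simp only [Pi.div_apply, slope_def_module, norm_smul, smul_eq_mul, abs_mul, norm_inv,
    Real.norm_eq_abs, abs_inv]
  rw [mul_div_mul_left _ _ (inv_ne_zero hv0)]

/-- For every `s ∈ ℝ`, the natural parameterization `r` of the unit sphere of a
2-dimensional real Banach space satisfies `‖r (s+ε) - r s‖ = (1 + o(1))·|ε|` as `ε → 0`,
i.e. `‖r (s+ε) - r s‖ / |ε| → 1` as `ε → 0`, `ε ≠ 0`. -/
theorem natural_parameterization_almost_isometric
    {X : Type*} [NormedAddCommGroup X] [NormedSpace ℝ X] [CompleteSpace X]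
    (hdim : Module.finrank ℝ X = 2)
    (e₁ e₂ : X) (hInd : LinearIndependent ℝ ![e₁, e₂])
    (p : ℝ → X)
    (hp : ∀ t, p t = ‖Real.cos t • e₁ + Real.sin t • e₂‖⁻¹ •
      (Real.cos t • e₁ + Real.sin t • e₂))
    (σ : ℝ → ℝ) (hσ : ∀ t, σ t = ∫ u in (0:ℝ)..t, ‖derivWithin p (Ici u) u‖)
    (τ : ℝ → ℝ) (hτ_cont : Continuous τ) (hτ_mono : StrictMono τ)
    (hστ : ∀ x, σ (τ x) = x)
    (r : ℝ → X) (hr : ∀ s, r s = p (τ s)) :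
    ∀ s : ℝ, Tendsto (fun ε : ℝ => ‖r (s + ε) - r s‖ / |ε|) (𝓝[≠] 0) (𝓝 1) := by
  intro s
  set t := τ s with ht
  set g : ℝ → ℝ := fun u => ‖derivWithin p (Ici u) u‖ with hg
  have hσ' : σ = fun t => ∫ u in (0:ℝ)..t, g u := funext hσ
  have hgm : StronglyMeasurable g := (stronglyMeasurable_derivWithin_Ici p).norm
  have hgT : ∀ x, (∃ c, Tendsto g (𝓝[>] x) (𝓝 c)) ∧ ∃ c, Tendsto g (𝓝[<] x) (𝓝 c) := by
    intro x
    obtain ⟨⟨d, -, -, h1⟩, ⟨d', -, -, h2⟩⟩ := aux_p e₁ e₂ hInd p hp x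
    exact ⟨⟨_, h1.norm⟩, ⟨_, h2.norm⟩⟩
  have hloc : LocallyIntegrable g volume := by
    intro x
    obtain ⟨⟨c, h1⟩, ⟨c', h2⟩⟩ := hgT x
    refine Measure.FiniteAtFilter.integrableAtFilter
      (hgm.aestronglyMeasurable.stronglyMeasurableAtFilter) (volume.finiteAt_nhds x) ?_
    obtain ⟨C1, hC1⟩ := h1.norm.isBoundedUnder_le
    obtain ⟨C2, hC2⟩ := h2.norm.isBoundedUnder_le
    rw [eventually_map] at hC1 hC2
    refine ⟨max (max C1 C2) ‖g x‖, ?_⟩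
    rw [eventually_map, ← nhdsNE_sup_pure, ← nhdsLT_sup_nhdsGT, eventually_sup, eventually_sup]
    refine ⟨⟨?_, ?_⟩, ?_⟩
    · filter_upwards [hC2] with y hy
      exact hy.trans ((le_max_right _ _).trans (le_max_left _ _))
    · filter_upwards [hC1] with y hy
      exact hy.trans ((le_max_left _ _).trans (le_max_left _ _))
    · exact le_max_right (max C1 C2) ‖g x‖
  have hii : ∀ x y, IntervalIntegrable g volume x y := fun x y => 
    (hloc.integrableOn_isCompact isCompact_uIcc).intervalIntegrable
  have hF : Tendsto (fun v => ‖p v - p t‖ / |σ v - σ t|) (𝓝[≠] t) (𝓝 1) := by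
    obtain ⟨⟨d, hd0, hd, hdT⟩, ⟨d', hd0', hd', hdT'⟩⟩ := aux_p e₁ e₂ hInd p hp t
    rw [← nhdsLT_sup_nhdsGT]
    refine Tendsto.sup ?_ ?_
    · rw [← Iic_sdiff_right]
      refine aux_ratio p σ t (Iic t) d' hd0' hd' ?_
      rw [hσ']
      refine intervalIntegral.integral_hasDerivWithinAt_of_tendsto_ae_right (t := Iic t) (hii 0 t)
        hgm.aestronglyMeasurable.stronglyMeasurableAtFilter ?_
      refine hdT'.norm.mono_left ?_
      rw [← Iic_sdiff_right, sdiff_eq, nhdsWithin_inter', inf_comm, inf_comm (𝓝[Iic t] t)]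
      refine inf_le_inf_right _ ?_
      rw [le_principal_iff]
      exact compl_mem_ae_iff.2 (by simp)
    · rw [← Ici_sdiff_left]
      refine aux_ratio p σ t (Ici t) d hd0 hd ?_
      rw [hσ']
      refine intervalIntegral.integral_hasDerivWithinAt_of_tendsto_ae_right (t := Ioi t) (hii 0 t)
        hgm.aestronglyMeasurable.stronglyMeasurableAtFilter ?_
      exact hdT.norm.mono_left inf_le_left
  have hτ : Tendsto (fun ε => τ (s + ε)) (𝓝[≠] 0) (𝓝[≠] t) := by
    rw [tendsto_nhdsWithin_iff]
    constructor
    · have : Continuous fun ε => τ (s + ε) := by fun_prop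
      have h := this.tendsto 0
      simp only [add_zero] at h
      exact h.mono_left nhdsWithin_le_nhds
    · filter_upwards [self_mem_nhdsWithin] with ε hε h
      have := hτ_mono.injective h
      exact hε (by simpa using this)
  refine (hF.comp hτ).congr fun ε => ?_
  simp [hr, hστ, ht]
end

section
/- For every s ∈ ℝ the radial and tangential jumps of the natural parameterization satisfy: (1) |ĵ(s)| < 1; (2) r'₋(s) = r'₊(s) if and only if j(s) = 0; (3) j(s) ≤ 0. -/
open Metric Set Filter Topology

lemma conv_right {f : ℝ → ℝ} (hf : ConvexOn ℝ univ f) (hc : Continuous f) (x₀ : ℝ) :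
    Tendsto (fun x => derivWithin f (Ioi x) x) (𝓝[>] x₀) (𝓝 (derivWithin f (Ioi x₀) x₀)) := by
  have hd := hf.hasDerivWithinAt_rightDeriv_of_mem_interior (x := x₀) (by simp)
  rw [hasDerivWithinAt_iff_tendsto_slope' (by simp)] at hd
  rw [tendsto_order]
  refine ⟨fun a ha => ?_, fun a ha => ?_⟩
  · filter_upwards [self_mem_nhdsWithin] with x hx
    exact ha.trans_le (hf.monotoneOn_rightDeriv (by simp) (by simp) (le_of_lt hx))
  · obtain ⟨y, hy, hya⟩ := (((tendsto_order.1 hd).2 a ha).and self_mem_nhdsWithin).exists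
    have hya' : x₀ < y := hya
    have hs : Tendsto (fun x => slope f x y) (𝓝 x₀) (𝓝 (slope f x₀ y)) := by
      simp only [slope_def_field]
      refine ContinuousAt.div (by fun_prop) (by fun_prop) (by linarith)
    filter_upwards [((tendsto_order.1 hs).2 a hy).filter_mono nhdsWithin_le_nhds,
      (eventually_lt_nhds hya').filter_mono nhdsWithin_le_nhds] with x h1 h2
    exact (hf.rightDeriv_le_slope_of_mem_interior (by simp) (by simp) h2).trans_lt h1

lemma conv_left {f : ℝ → ℝ} (hf : ConvexOn ℝ univ f) (hc : Continuous f) (x₀ : ℝ) :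
    Tendsto (fun x => derivWithin f (Ioi x) x) (𝓝[<] x₀) (𝓝 (derivWithin f (Iio x₀) x₀)) := by
  have hd := hf.hasDerivWithinAt_leftDeriv_of_mem_interior (x := x₀) (by simp)
  rw [hasDerivWithinAt_iff_tendsto_slope' (by simp)] at hd
  rw [tendsto_order]
  refine ⟨fun a ha => ?_, fun a ha => ?_⟩
  · obtain ⟨y, hy, hya⟩ := (((tendsto_order.1 hd).1 a ha).and self_mem_nhdsWithin).exists
    have hya' : y < x₀ := hya
    rw [slope_comm] at hy
    have hs : Tendsto (fun x => slope f y x) (𝓝 x₀) (𝓝 (slope f y x₀)) := by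
      simp only [slope_def_field]
      refine ContinuousAt.div (by fun_prop) (by fun_prop) (by linarith)
    filter_upwards [((tendsto_order.1 hs).1 a hy).filter_mono nhdsWithin_le_nhds,
      (eventually_gt_nhds hya').filter_mono nhdsWithin_le_nhds] with x h1 h2
    exact h1.trans_le ((hf.slope_le_leftDeriv_of_mem_interior (by simp) (by simp) h2).trans
      (hf.leftDeriv_le_rightDeriv_of_mem_interior (by simp)))
  · filter_upwards [(tendsto_order.1 hd).2 a ha, self_mem_nhdsWithin] with x h1 hx
    rw [slope_comm] at h1
    exact (hf.rightDeriv_le_slope_of_mem_interior (by simp) (by simp) hx).trans_lt h1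

lemma key {X : Type*} [NormedAddCommGroup X] [NormedSpace ℝ X] (u v : X)
    (huv : ∀ a b : ℝ, a • u + b • v = 0 → a = 0 ∧ b = 0) (t₀ : ℝ) (p : ℝ → X)
    (hp : ∀ t, p t = ‖Real.cos (t - t₀) • u + Real.sin (t - t₀) • v‖⁻¹ •
      (Real.cos (t - t₀) • u + Real.sin (t - t₀) • v)) :
    ∃ am ap : ℝ, am ≤ ap ∧
      HasDerivWithinAt p (‖u‖⁻¹ • v - ap • u) (Ici t₀) t₀ ∧
      HasDerivWithinAt p (‖u‖⁻¹ • v - am • u) (Iic t₀) t₀ ∧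
      Tendsto (fun t => derivWithin p (Ici t) t) (𝓝[>] t₀) (𝓝 (‖u‖⁻¹ • v - ap • u)) ∧
      Tendsto (fun t => derivWithin p (Ici t) t) (𝓝[<] t₀) (𝓝 (‖u‖⁻¹ • v - am • u)) := by
  set f : ℝ → ℝ := fun x => ‖u + x • v‖ with hfdef
  have hc : Continuous f := by fun_prop
  have hpos : ∀ x, 0 < f x := fun x => by
    refine norm_pos_iff.2 fun h => ?_
    have := (huv 1 x (by simpa using h)).1
    norm_num at this
  have hf : ConvexOn ℝ univ f := by
    refine ⟨convex_univ, fun x _ y _ a b ha hb hab => ?_⟩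
    have : u + (a • x + b • y) • v = a • (u + x • v) + b • (u + y • v) := by
      have : u = (a + b) • u := by rw [hab, one_smul]
      nth_rewrite 1 [this]
      simp only [smul_eq_mul]; module
    simp only [hfdef]
    rw [this]
    refine (norm_add_le _ _).trans ?_
    rw [norm_smul, norm_smul, Real.norm_of_nonneg ha, Real.norm_of_nonneg hb]
    rfl
  set q : ℝ → X := fun x => (f x)⁻¹ • (u + x • v) with hq
  set Q : ℝ → ℝ → X := fun x d => (f x)⁻¹ • v + (-d / f x ^ 2) • (u + x • v) with hQ
  have hqd : ∀ x d S, HasDerivWithinAt f d S x → HasDerivWithinAt q (Q x d) S x := by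
    intro x d S h
    have h1 : HasDerivWithinAt (fun x : ℝ => u + x • v) v S x := by
      simpa using ((hasDerivWithinAt_id x S).smul_const v).const_add u
    exact (h.inv (hpos x).ne').smul h1
  have hpq : ∀ t, |t - t₀| < Real.pi / 2 → p t = q (Real.tan (t - t₀)) := by
    intro t ht
    have hcos : 0 < Real.cos (t - t₀) := Real.cos_pos_of_mem_Ioo (abs_lt.1 ht)
    have e : Real.cos (t - t₀) • u + Real.sin (t - t₀) • v
        = Real.cos (t - t₀) • (u + Real.tan (t - t₀) • v) := by
      rw [smul_add, smul_smul, Real.tan_eq_sin_div_cos, mul_div_cancel₀ _ hcos.ne']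
    rw [hp, e, norm_smul, Real.norm_of_nonneg hcos.le, smul_smul]
    simp only [hq, hfdef]
    congr 1
    field_simp
  have hcosne : ∀ t, |t - t₀| < Real.pi / 2 → Real.cos (t - t₀) ≠ 0 := fun t ht =>
    (Real.cos_pos_of_mem_Ioo (abs_lt.1 ht)).ne'
  have htan : ∀ t, |t - t₀| < Real.pi / 2 →
      HasDerivAt (fun t => Real.tan (t - t₀)) (1 / Real.cos (t - t₀) ^ 2) t := by
    intro t ht
    simpa using (Real.hasDerivAt_tan (hcosne t ht)).comp_sub_const t t₀
  have hnear : ∀ t, |t - t₀| < Real.pi / 2 → ∀ᶠ t' in 𝓝 t, |t' - t₀| < Real.pi / 2 := by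
    intro t ht
    exact (by fun_prop : Continuous fun t' : ℝ => |t' - t₀|).continuousAt.eventually_lt
      continuousAt_const ht
  have hmono : ∀ a b, |a - t₀| < Real.pi / 2 → |b - t₀| < Real.pi / 2 → a ≤ b →
      Real.tan (a - t₀) ≤ Real.tan (b - t₀) := by
    intro a b ha hb hab
    exact Real.strictMonoOn_tan.monotoneOn (abs_lt.1 ha) (abs_lt.1 hb) (by linarith)
  -- chain rule
  have hchain : ∀ t d (S T : Set ℝ), |t - t₀| < Real.pi / 2 → t ∈ S →
      (∀ t' ∈ S, |t' - t₀| < Real.pi / 2 → Real.tan (t' - t₀) ∈ T) →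
      HasDerivWithinAt f d T (Real.tan (t - t₀)) →
      HasDerivWithinAt p ((1 / Real.cos (t - t₀) ^ 2) • Q (Real.tan (t - t₀)) d) S t := by
    intro t d S T ht htS hST h
    have h1 := (hqd _ _ _ h).scomp (h := fun t => Real.tan (t - t₀))
      (s := S ∩ {t' | |t' - t₀| < Real.pi / 2}) t (htan t ht).hasDerivWithinAt
      (fun t' h' => hST t' h'.1 h'.2)
    have h2 : HasDerivWithinAt p ((1 / Real.cos (t - t₀) ^ 2) • Q (Real.tan (t - t₀)) d)
        (S ∩ {t' | |t' - t₀| < Real.pi / 2}) t :=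
      h1.congr (fun t' h' => hpq t' h'.2) (hpq t ht)
    exact (hasDerivWithinAt_inter (hnear t ht)).1 h2
  have ht0 : |t₀ - t₀| < Real.pi / 2 := by simp; positivity
  have hR : ∀ x, HasDerivWithinAt f (derivWithin f (Ioi x) x) (Ici x) x := fun x =>
    (hf.hasDerivWithinAt_rightDeriv_of_mem_interior (by simp)).Ici_of_Ioi
  have hLf : HasDerivWithinAt f (derivWithin f (Iio 0) 0) (Iic 0) 0 :=
    (hf.hasDerivWithinAt_leftDeriv_of_mem_interior (by simp)).Iic_of_Iio
  have hpR : ∀ t, |t - t₀| < Real.pi / 2 → derivWithin p (Ici t) t =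
      (1 / Real.cos (t - t₀) ^ 2) • Q (Real.tan (t - t₀))
        (derivWithin f (Ioi (Real.tan (t - t₀))) (Real.tan (t - t₀))) := by
    intro t ht
    exact (hchain t _ (Ici t) (Ici _) ht self_mem_Ici
      (fun t' h' h'' => hmono _ _ ht h'' h') (hR _)).derivWithin (uniqueDiffOn_Ici t t self_mem_Ici)
  have hQ0 : ∀ d, (1 / Real.cos (t₀ - t₀) ^ 2) • Q (Real.tan (t₀ - t₀)) d
      = ‖u‖⁻¹ • v - (d / ‖u‖ ^ 2) • u := by
    intro d
    simp only [hQ, hfdef]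
    simp [neg_div, sub_eq_add_neg]
  have htt : Tendsto (fun t => Real.tan (t - t₀)) (𝓝 t₀) (𝓝 0) := by
    simpa using (htan t₀ ht0).continuousAt.tendsto
  have hlim : ∀ (l : Filter ℝ) (d : ℝ), l ≤ 𝓝 t₀ →
      Tendsto (fun t => derivWithin f (Ioi (Real.tan (t - t₀))) (Real.tan (t - t₀))) l (𝓝 d) →
      Tendsto (fun t => derivWithin p (Ici t) t) l (𝓝 (‖u‖⁻¹ • v - (d / ‖u‖ ^ 2) • u)) := by
    intro l d hl h
    have h1 : Tendsto (fun t => (1 / Real.cos (t - t₀) ^ 2) • Q (Real.tan (t - t₀))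
        (derivWithin f (Ioi (Real.tan (t - t₀))) (Real.tan (t - t₀)))) l
        (𝓝 ((1 / Real.cos (t₀ - t₀) ^ 2) • Q (Real.tan (t₀ - t₀)) d)) := by
      have ht := (htan t₀ ht0).continuousAt.tendsto.mono_left hl
      have hff := (hc.tendsto _).comp ht
      refine Tendsto.smul (Tendsto.div tendsto_const_nhds ?_ (by simp)) ?_
      · exact ((by fun_prop : Continuous fun t => Real.cos (t - t₀) ^ 2).tendsto t₀).mono_left hl
      · refine ((hff.inv₀ (hpos _).ne').smul_const v).add ?_
        exact (h.neg.div (hff.pow 2) (pow_ne_zero _ (hpos _).ne')).smul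
          ((ht.smul_const v).const_add u)
    rw [hQ0] at h1
    refine h1.congr' ?_
    filter_upwards [hl (hnear t₀ ht0)] with t ht
    exact (hpR t ht).symm
  have hu : 0 < ‖u‖ := by simpa [hfdef] using hpos 0
  have z : Real.tan (t₀ - t₀) = 0 := by simp
  refine ⟨derivWithin f (Iio 0) 0 / ‖u‖ ^ 2, derivWithin f (Ioi 0) 0 / ‖u‖ ^ 2, ?_, ?_, ?_, ?_, ?_⟩
  · have := hf.leftDeriv_le_rightDeriv_of_mem_interior (x := 0) (by simp)
    gcongr
  · rw [← hQ0]
    refine hchain t₀ _ (Ici t₀) (Ici 0) ht0 self_mem_Ici (fun t' h' h'' => ?_) (by rw [z]; exact hR 0)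
    rw [mem_Ici, ← z]; exact hmono _ _ ht0 h'' h'
  · rw [← hQ0]
    refine hchain t₀ _ (Iic t₀) (Iic 0) ht0 self_mem_Iic (fun t' h' h'' => ?_) (by rw [z]; exact hLf)
    rw [mem_Iic, ← z]; exact hmono _ _ h'' ht0 h'
  · refine hlim _ _ nhdsWithin_le_nhds ((conv_right hf hc 0).comp ?_)
    refine tendsto_nhdsWithin_iff.2 ⟨htt.mono_left nhdsWithin_le_nhds, ?_⟩
    filter_upwards [self_mem_nhdsWithin, nhdsWithin_le_nhds (hnear t₀ ht0)] with t h1 h2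
    rw [mem_Ioi, ← z]
    exact Real.strictMonoOn_tan (abs_lt.1 ht0) (abs_lt.1 h2) (sub_lt_sub_right h1 _)
  · refine hlim _ _ nhdsWithin_le_nhds ((conv_left hf hc 0).comp ?_)
    refine tendsto_nhdsWithin_iff.2 ⟨htt.mono_left nhdsWithin_le_nhds, ?_⟩
    filter_upwards [self_mem_nhdsWithin, nhdsWithin_le_nhds (hnear t₀ ht0)] with t h1 h2
    rw [mem_Iio, ← z]
    exact Real.strictMonoOn_tan (abs_lt.1 h2) (abs_lt.1 ht0) (sub_lt_sub_right h1 _)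

lemma slope_rel {X : Type*} [NormedAddCommGroup X] [NormedSpace ℝ X]
    (p r : ℝ → X) (σ τ : ℝ → ℝ) (s : ℝ) (A B : Set ℝ) (P d : X) (n : ℝ)
    (hτc : Continuous τ) (hτm : StrictMono τ) (hAB : MapsTo τ A B)
    [(𝓝[A \ {s}] s).NeBot]
    (hστ : ∀ x, σ (τ x) = x) (hr : ∀ s, r s = p (τ s))
    (hp : HasDerivWithinAt p P B (τ s)) (hσ : HasDerivWithinAt σ n B (τ s))
    (hd : HasDerivWithinAt r d A s) : n • d = P := by
  rw [hasDerivWithinAt_iff_tendsto_slope] at hp hσ hd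
  have hT : Tendsto τ (𝓝[A \ {s}] s) (𝓝[B \ {τ s}] (τ s)) := by
    refine tendsto_nhdsWithin_iff.2 ⟨(hτc.tendsto s).mono_left nhdsWithin_le_nhds, ?_⟩
    filter_upwards [self_mem_nhdsWithin] with x hx
    exact ⟨hAB hx.1, fun h => hx.2 (hτm.injective h)⟩
  have h1 := (hσ.comp hT).smul hd
  refine tendsto_nhds_unique (h1.congr' ?_) (hp.comp hT)
  filter_upwards [self_mem_nhdsWithin] with x hx
  have hx' : x - s ≠ 0 := sub_ne_zero.2 hx.2
  simp only [Function.comp, slope, vsub_eq_sub, hστ, hr, smul_smul, smul_eq_mul]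
  congr 1
  field_simp

lemma sigma_deriv {X : Type*} [NormedAddCommGroup X] [NormedSpace ℝ X] [CompleteSpace X]
    (p : ℝ → X) (σ : ℝ → ℝ) (hσ : ∀ t, σ t = ∫ u in (0:ℝ)..t, ‖derivWithin p (Ici u) u‖)
    (h : ∀ t, ∃ a b : X, Tendsto (fun t => derivWithin p (Ici t) t) (𝓝[>] t) (𝓝 a) ∧
      Tendsto (fun t => derivWithin p (Ici t) t) (𝓝[<] t) (𝓝 b)) (t : ℝ) (a b : X)
    (ha : Tendsto (fun t => derivWithin p (Ici t) t) (𝓝[>] t) (𝓝 a))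
    (hb : Tendsto (fun t => derivWithin p (Ici t) t) (𝓝[<] t) (𝓝 b)) :
    HasDerivWithinAt σ ‖a‖ (Ici t) t ∧ HasDerivWithinAt σ ‖b‖ (Iic t) t := by
  have hm : MeasureTheory.StronglyMeasurable (fun u => ‖derivWithin p (Ici u) u‖) :=
    (stronglyMeasurable_derivWithin_Ici p).norm
  have hσ' : σ = fun t => ∫ u in (0:ℝ)..t, ‖derivWithin p (Ici u) u‖ := funext hσ
  have hloc : MeasureTheory.LocallyIntegrable (fun u => ‖derivWithin p (Ici u) u‖) := by
    intro t
    obtain ⟨a, b, h1, h2⟩ := h t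
    refine (MeasureTheory.volume.finiteAt_nhds t).integrableAtFilter
      hm.aestronglyMeasurable.stronglyMeasurableAtFilter ?_
    have e : 𝓝 t = 𝓝[<] t ⊔ 𝓝[>] t ⊔ pure t := by
      rw [← nhdsWithin_union, ← nhdsNE_sup_pure, Iio_union_Ioi]
    obtain ⟨c1, hc1⟩ := h1.norm.norm.isBoundedUnder_le
    obtain ⟨c2, hc2⟩ := h2.norm.norm.isBoundedUnder_le
    rw [eventually_map] at hc1 hc2
    refine ⟨max (max c1 c2) ‖‖derivWithin p (Ici t) t‖‖, ?_⟩
    rw [eventually_map, e, eventually_sup, eventually_sup, eventually_pure]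
    refine ⟨⟨?_, ?_⟩, le_max_right _ _⟩
    · filter_upwards [hc2] with x hx
      exact le_max_of_le_left (le_max_of_le_right hx)
    · filter_upwards [hc1] with x hx
      exact le_max_of_le_left (le_max_of_le_left hx)
  have hint : IntervalIntegrable (fun u => ‖derivWithin p (Ici u) u‖) MeasureTheory.volume 0 t :=
    (hloc.integrableOn_isCompact isCompact_uIcc).intervalIntegrable
  have hle : 𝓝[≤] t ⊓ MeasureTheory.ae MeasureTheory.volume ≤ 𝓝[<] t := by
    refine le_inf (inf_le_left.trans nhdsWithin_le_nhds) (le_principal_iff.2 ?_)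
    have h1 : {t}ᶜ ∈ MeasureTheory.ae (MeasureTheory.volume : MeasureTheory.Measure ℝ) :=
      MeasureTheory.compl_mem_ae_iff.2 (by simp)
    filter_upwards [mem_inf_of_left (self_mem_nhdsWithin : Iic t ∈ 𝓝[≤] t), mem_inf_of_right h1]
      with x hx hx'
    exact lt_of_le_of_ne hx hx'
  rw [hσ']
  exact ⟨intervalIntegral.integral_hasDerivWithinAt_of_tendsto_ae_right (t := Ioi t) hint
      hm.aestronglyMeasurable.stronglyMeasurableAtFilter (ha.norm.mono_left inf_le_left),
    intervalIntegral.integral_hasDerivWithinAt_of_tendsto_ae_right (t := Iic t) hint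
      hm.aestronglyMeasurable.stronglyMeasurableAtFilter (hb.norm.mono_left hle)⟩

/-- Properties of the radial jump `j s` and tangential jump `jhat s` of the derivative of the
natural parameterization `r` at a point `s`: `|jhat s| < 1`; the one-sided derivatives agree
iff `j s = 0`; and `j s ≤ 0`. -/
theorem natural_parameterization_jumps
    {X : Type*} [NormedAddCommGroup X] [NormedSpace ℝ X] [CompleteSpace X]
    (hdim : Module.finrank ℝ X = 2)
    (e₁ e₂ : X) (hInd : LinearIndependent ℝ ![e₁, e₂])
    (p : ℝ → X)
    (hp : ∀ t, p t = ‖Real.cos t • e₁ + Real.sin t • e₂‖⁻¹ •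
      (Real.cos t • e₁ + Real.sin t • e₂))
    (σ : ℝ → ℝ) (hσ : ∀ t, σ t = ∫ u in (0:ℝ)..t, ‖derivWithin p (Ici u) u‖)
    (τ : ℝ → ℝ) (hτ_cont : Continuous τ) (hτ_mono : StrictMono τ)
    (hστ : ∀ x, σ (τ x) = x)
    (r : ℝ → X) (hr : ∀ s, r s = p (τ s))
    (s : ℝ)
    -- the one-sided derivatives of `r` at `s`
    (dm dp : X)
    (hdm : HasDerivWithinAt r dm (Iic s) s) (hdp : HasDerivWithinAt r dp (Ici s) s)
    -- the radial jump `j` and tangential jump `jhat` at `s`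
    (j jhat : ℝ)
    (hjj : (1/2 : ℝ) • (dp - dm) = j • r s + jhat • ((1/2 : ℝ) • (dp + dm))) :
    |jhat| < 1 ∧ (dm = dp ↔ j = 0) ∧ j ≤ 0 := by
  have hind : ∀ a b : ℝ, a • e₁ + b • e₂ = 0 → a = 0 ∧ b = 0 :=
    LinearIndependent.pair_iff.1 hInd
  -- rotated frames
  have hind' : ∀ t a b : ℝ, a • (Real.cos t • e₁ + Real.sin t • e₂) +
      b • (-Real.sin t • e₁ + Real.cos t • e₂) = 0 → a = 0 ∧ b = 0 := by
    intro t a b h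
    have h1 := hind (a * Real.cos t - b * Real.sin t) (a * Real.sin t + b * Real.cos t)
      (by rw [← h]; module)
    have h2 := Real.sin_sq_add_cos_sq t
    constructor
    · linear_combination Real.cos t * h1.1 + Real.sin t * h1.2 - a * h2
    · linear_combination -Real.sin t * h1.1 + Real.cos t * h1.2 - b * h2
  have hkey := fun t₀ : ℝ => key (Real.cos t₀ • e₁ + Real.sin t₀ • e₂)
    (-Real.sin t₀ • e₁ + Real.cos t₀ • e₂) (hind' t₀) t₀ p (by
      intro t
      have e : Real.cos (t - t₀) • (Real.cos t₀ • e₁ + Real.sin t₀ • e₂) +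
          Real.sin (t - t₀) • (-Real.sin t₀ • e₁ + Real.cos t₀ • e₂)
          = Real.cos t • e₁ + Real.sin t • e₂ := by
        have h1 : Real.cos t = Real.cos (t - t₀) * Real.cos t₀ - Real.sin (t - t₀) * Real.sin t₀ := by
          rw [← Real.cos_add, sub_add_cancel]
        have h2 : Real.sin t = Real.sin (t - t₀) * Real.cos t₀ + Real.cos (t - t₀) * Real.sin t₀ := by
          rw [← Real.sin_add, sub_add_cancel]
        rw [h1, h2]; module
      rw [e, hp])
  obtain ⟨am, ap, hle, hR, hL, tR, tL⟩ := hkey (τ s)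
  have hrs : r s = ‖Real.cos (τ s) • e₁ + Real.sin (τ s) • e₂‖⁻¹ •
      (Real.cos (τ s) • e₁ + Real.sin (τ s) • e₂) := by rw [hr, hp]
  have huv := hind' (τ s)
  set u := Real.cos (τ s) • e₁ + Real.sin (τ s) • e₂ with hu
  set v := -Real.sin (τ s) • e₁ + Real.cos (τ s) • e₂ with hv
  obtain ⟨sR, sL⟩ := sigma_deriv p σ hσ (fun t => by
    obtain ⟨_, _, _, _, _, h1, h2⟩ := hkey t
    exact ⟨_, _, h1, h2⟩) (τ s) _ _ tR tL
  have : (𝓝[Ici s \ {s}] s).NeBot := by rw [Ici_sdiff_left]; infer_instance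
  have : (𝓝[Iic s \ {s}] s).NeBot := by rw [Iic_sdiff_right]; infer_instance
  have hP := slope_rel p r σ τ s (Ici s) (Ici (τ s)) _ dp _ hτ_cont hτ_mono
    (fun x hx => hτ_mono.monotone hx) hστ hr hR sR hdp
  have hM := slope_rel p r σ τ s (Iic s) (Iic (τ s)) _ dm _ hτ_cont hτ_mono
    (fun x hx => hτ_mono.monotone hx) hστ hr hL sL hdm
  have hN : 0 < ‖u‖ := norm_pos_iff.2 fun h => by
    have := (huv 1 0 (by simp [h])).1
    norm_num at this
  have hne : ∀ a : ℝ, 0 < ‖‖u‖⁻¹ • v - a • u‖ := fun a => norm_pos_iff.2 fun h => by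
    have := (huv (-a) ‖u‖⁻¹ (by rw [← h]; module)).2
    exact (inv_pos.2 hN).ne' this
  have hnp := hne ap
  have hnm := hne am
  have heq : ap = am → dp = dm := fun h => by
    rw [h] at hP
    exact smul_right_injective X hnm.ne' (hP.trans hM.symm)
  generalize ‖‖u‖⁻¹ • v - ap • u‖ = np at hP hnp
  generalize ‖‖u‖⁻¹ • v - am • u‖ = nm at hM hnm
  generalize ‖u‖ = N at *
  have hdp' : dp = np⁻¹ • (N⁻¹ • v - ap • u) := by
    rw [← hP, smul_smul, inv_mul_cancel₀ hnp.ne', one_smul]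
  have hdm' : dm = nm⁻¹ • (N⁻¹ • v - am • u) := by
    rw [← hM, smul_smul, inv_mul_cancel₀ hnm.ne', one_smul]
  have hM0 : 0 < N⁻¹ := inv_pos.2 hN
  have hx0 : 0 < np⁻¹ := inv_pos.2 hnp
  have hy0 : 0 < nm⁻¹ := inv_pos.2 hnm
  generalize N⁻¹ = M at *
  generalize np⁻¹ = x at *
  generalize nm⁻¹ = y at *
  rw [hdp', hdm', hrs] at hjj
  obtain ⟨h1, h2⟩ := huv (-(x * ap) + y * am - 2 * j * M + jhat * (x * ap + y * am))
    (M * (x - y - jhat * (x + y))) (by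
      have h3 := sub_eq_zero.2 hjj
      have h4 : (2 : ℝ) • ((1/2 : ℝ) • (x • (M • v - ap • u) - y • (M • v - am • u)) - (j • M • u +
        jhat • (1/2 : ℝ) • (x • (M • v - ap • u) + y • (M • v - am • u)))) = 0 := by
        rw [h3, smul_zero]
      rw [← h4]; module)
  have h2' : x - y - jhat * (x + y) = 0 := (mul_eq_zero.1 h2).resolve_left hM0.ne'
  have hxy : 0 < x + y := by positivity
  have hj : jhat = (x - y) / (x + y) := by field_simp; linarith
  have hk : (1 - jhat) * x = 2 * x * y / (x + y) := by rw [hj]; field_simp; ring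
  have hk' : (1 + jhat) * y = 2 * x * y / (x + y) := by rw [hj]; field_simp; ring
  have hk0 : 0 < 2 * x * y / (x + y) := by positivity
  generalize 2 * x * y / (x + y) = k at hk hk' hk0
  have h5 : 2 * j * M = -k * (ap - am) := by linear_combination -h1 - ap * hk + am * hk'
  refine ⟨?_, ⟨fun h => ?_, fun h => ?_⟩, ?_⟩
  · rw [abs_lt]
    constructor
    · by_contra hcon
      nlinarith
    · by_contra hcon
      nlinarith
  · rw [hdp', hdm'] at h
    obtain ⟨h6, h7⟩ := huv (x * ap - y * am) (M * (y - x)) (by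
      rw [← sub_eq_zero] at h; rw [← h]; module)
    have h8 : y - x = 0 := (mul_eq_zero.1 h7).resolve_left hM0.ne'
    have h9 : y = x := by linarith
    subst h9
    have h10 : ap - am = 0 :=
      (mul_eq_zero.1 (show y * (ap - am) = 0 by linarith)).resolve_left hy0.ne'
    rw [h10, mul_zero] at h5
    have := (mul_eq_zero.1 h5).resolve_right hM0.ne'
    linarith
  · rw [h] at h5
    have h10 : ap - am = 0 :=
      (mul_eq_zero.1 (show k * (ap - am) = 0 by linarith)).resolve_left hk0.ne'
    have h11 : ap = am := by linarith
    exact (heq h11).symm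
  · by_contra hcon
    push Not at hcon
    have : 0 < 2 * j * M := by positivity
    nlinarith
end

section
/- Let a, b, s ∈ ℝ be such that the natural parameterization r is differentiable at b and 0 ≠ r(b) − r(a) = ‖r(b) − r(a)‖·r(s), and write r'(b) = x·r(s) + y·r'±(s) with x, y ∈ ℝ, y ≠ 0. Then y > 0 and the function ν(ε) = ‖r(b+ε) − r(a)‖ has one-sided derivatives at 0 given by ν'₊(0) = x − j(s)·y/(1 + ĵ(s)) and ν'₋(0) = x + j(s)·y/(1 − ĵ(s)); equivalently, ‖r(b+ε) − r(a)‖ = ‖r(b) − r(a)‖ + x·ε − (sign(ε)·j(s)·y/(1 + sign(ε)·ĵ(s)))·ε + o(ε) as ε → 0. -/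
open Metric Set Filter Topology

lemma aux_compare {X : Type*} [NormedAddCommGroup X] [NormedSpace ℝ X]
    {f g : ℝ → X} {d : X} {q : ℝ} {S : Set ℝ}
    (hf : HasDerivWithinAt f d S 0) (hg : HasDerivWithinAt g d S 0) (h0 : f 0 = g 0)
    (hq : HasDerivWithinAt (fun t => ‖f t‖) q S 0) :
    HasDerivWithinAt (fun t => ‖g t‖) q S 0 := by
  rw [hasDerivWithinAt_iff_isLittleO] at *
  have h1 := hg.sub hf
  have h2 : (fun t => ‖g t‖ - ‖f t‖) =o[𝓝[S] (0:ℝ)] fun t => t - 0 := by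
    refine Asymptotics.IsBigO.trans_isLittleO ?_ h1
    refine Asymptotics.IsBigO.of_bound 1 (Eventually.of_forall fun t => ?_)
    have : (g t - g 0 - (t - 0) • d) - (f t - f 0 - (t - 0) • d) = g t - f t := by
      rw [h0]; abel
    rw [this, one_mul]
    exact abs_norm_sub_norm_le _ _
  refine (hq.add h2).congr_left fun t => ?_
  simp only [h0]
  ring

lemma aux_onesided {X : Type*} [NormedAddCommGroup X] [NormedSpace ℝ X]
    {r g : ℝ → X} {d : X} {s c A B : ℝ} {S T : Set ℝ} (hr1 : ∀ t, ‖r t‖ = 1)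
    (hd : HasDerivWithinAt r d T s) (hc : 0 < c)
    (hg0 : g 0 = c • r s)
    (hST : ∀ t ∈ S, s + (B / c) * t ∈ T)
    (hg : HasDerivWithinAt g (A • r s + B • d) S 0) :
    HasDerivWithinAt (fun t => ‖g t‖) A S 0 := by
  have hlin : HasDerivWithinAt (fun t : ℝ => s + (B / c) * t) (B / c) S 0 := by
    simpa using ((hasDerivWithinAt_id (0:ℝ) S).const_mul (B / c)).const_add s
  have hlin2 : HasDerivWithinAt (fun t : ℝ => c + A * t) A S 0 := by
    simpa using ((hasDerivWithinAt_id (0:ℝ) S).const_mul A).const_add c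
  have hcomp : HasDerivWithinAt (r ∘ fun t : ℝ => s + (B / c) * t) ((B / c) • d) S 0 :=
    HasDerivWithinAt.scomp_of_eq (y := s) (t' := T) 0 hd hlin hST (by simp)
  have hf : HasDerivWithinAt (fun t : ℝ => (c + A * t) • r (s + (B / c) * t))
      (A • r s + B • d) S 0 := by
    have h := hlin2.fun_smul hcomp
    refine h.congr_deriv ?_
    simp only [Function.comp, mul_zero, add_zero, smul_smul]
    rw [mul_div_cancel₀ _ hc.ne', add_comm]
  refine aux_compare hf hg (by simp [hg0]) ?_
  have hev : (fun t : ℝ => ‖(c + A * t) • r (s + (B / c) * t)‖) =ᶠ[𝓝[S] 0] fun t => c + A * t := by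
    have : ∀ᶠ t : ℝ in 𝓝 0, 0 < c + A * t := by
      have hcont : Continuous fun t : ℝ => c + A * t := by fun_prop
      exact hcont.continuousAt.eventually_const_lt (by simpa using hc)
    filter_upwards [nhdsWithin_le_nhds this] with t ht
    rw [norm_smul, hr1, mul_one, Real.norm_of_nonneg ht.le]
  refine hlin2.congr_of_eventuallyEq hev ?_
  simp [norm_smul, hr1, abs_of_pos hc]

lemma aux_min {X : Type*} [NormedAddCommGroup X] [NormedSpace ℝ X]
    {r : ℝ → X} {v : X} {b : ℝ} (hr1 : ∀ t, ‖r t‖ = 1) (hb : HasDerivAt r v b) (t : ℝ) :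
    1 ≤ ‖r b + t • v‖ := by
  have h1 : HasDerivWithinAt (fun t : ℝ => r b + t • v) v univ 0 := by
    simpa using (((hasDerivWithinAt_id (0:ℝ) univ).smul_const v).const_add (r b))
  have h2 : HasDerivWithinAt (fun t : ℝ => ‖r b + t • v‖) 0 univ 0 := by
    refine aux_onesided (r := r) (d := v) (s := b) (c := 1) (A := 0) (B := 1) (T := univ) hr1
      hb.hasDerivWithinAt one_pos (by simp) (by simp) ?_
    simpa using h1
  have hconv : ConvexOn ℝ univ (fun t : ℝ => ‖r b + t • v‖) := by
    refine ⟨convex_univ, fun p _ q _ α β hα hβ hαβ => ?_⟩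
    have : r b + (α • p + β • q) • v = α • (r b + p • v) + β • (r b + q • v) := by
      have : r b = (α + β) • r b := by rw [hαβ, one_smul]
      nth_rewrite 1 [this]
      simp only [smul_eq_mul]
      module
    simp only [this]
    refine (norm_add_le _ _).trans ?_
    rw [norm_smul, norm_smul, Real.norm_of_nonneg hα, Real.norm_of_nonneg hβ]
    rfl
  have hm := hconv.isMinOn_of_rightDeriv_eq_zero (x := 0) (by simp)
    ((h2.mono (subset_univ _)).derivWithin (uniqueDiffWithinAt_Ioi 0))
  have := hm (mem_univ t)
  simpa [hr1] using this

lemma aux_p_lip {X : Type*} [NormedAddCommGroup X] [NormedSpace ℝ X]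
    {u : ℝ → X} {K L : ℝ} (hL : ∀ t t', ‖u t - u t'‖ ≤ L * |t - t'|) (hK0 : 0 < K)
    (hK : ∀ t, 1 ≤ K * ‖u t‖) (t t' : ℝ) :
    ‖‖u t‖⁻¹ • u t - ‖u t'‖⁻¹ • u t'‖ ≤ 2 * K * L * |t - t'| := by
  have hpos : ∀ t, 0 < ‖u t‖ := fun t => by
    by_contra h
    have := hK t
    nlinarith [norm_nonneg (u t)]
  have e : ‖u t‖⁻¹ • u t - ‖u t'‖⁻¹ • u t' =
      ‖u t‖⁻¹ • (u t - u t') + (‖u t‖⁻¹ * (‖u t'‖ - ‖u t‖)) • (‖u t'‖⁻¹ • u t') := by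
    rw [smul_smul, mul_sub, sub_mul, inv_mul_cancel₀ (hpos t).ne', mul_assoc,
      mul_inv_cancel₀ (hpos t').ne']
    module
  have hn : ‖‖u t'‖⁻¹ • u t'‖ = 1 := by
    rw [norm_smul, norm_inv, norm_norm, inv_mul_cancel₀ (hpos t').ne']
  have hi : ‖u t‖⁻¹ ≤ K := by
    rw [inv_le_iff_one_le_mul₀ (hpos t)]; exact hK t
  rw [e]
  refine (norm_add_le _ _).trans ?_
  rw [norm_smul _ (‖u t'‖⁻¹ • u t'), hn, norm_smul, norm_mul, norm_inv, norm_norm]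
  have h1 : ‖‖u t'‖ - ‖u t‖‖ ≤ ‖u t - u t'‖ := by
    rw [norm_sub_rev (u t)]; exact abs_norm_sub_norm_le _ _
  have h2 := hL t t'
  have h3 : ‖u t‖⁻¹ * ‖u t - u t'‖ ≤ K * (L * |t - t'|) := by gcongr
  have h4 : ‖u t‖⁻¹ * ‖‖u t'‖ - ‖u t‖‖ ≤ K * (L * |t - t'|) := by
    gcongr; exact h1.trans h2
  linarith

lemma aux_sigma {X : Type*} [NormedAddCommGroup X] [NormedSpace ℝ X] [CompleteSpace X]
    {p : ℝ → X} {M : ℝ} (hM0 : 0 ≤ M) (hM : ∀ t t', ‖p t - p t'‖ ≤ M * |t - t'|)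
    {σ : ℝ → ℝ} (hσ : ∀ t, σ t = ∫ u in (0:ℝ)..t, ‖derivWithin p (Ici u) u‖) (t t' : ℝ) :
    σ t - σ t' ≤ M * |t - t'| := by
  have hbd : ∀ u, ‖derivWithin p (Ici u) u‖ ≤ M := by
    intro u
    by_cases hd : DifferentiableWithinAt ℝ p (Ici u) u
    · have h := hasDerivWithinAt_iff_tendsto_slope.1 hd.hasDerivWithinAt
      have hne : (𝓝[Ici u \ {u}] u).NeBot := by
        rw [Ici_sdiff_left]; infer_instance
      refine le_of_tendsto h.norm ?_
      filter_upwards [self_mem_nhdsWithin] with z hz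
      have hz' : 0 < |z - u| := abs_pos.2 (sub_ne_zero.2 hz.2)
      rw [slope_def_module, norm_smul, norm_inv, Real.norm_eq_abs, inv_mul_le_iff₀ hz', mul_comm]
      exact hM z u
    · rw [derivWithin_zero_of_not_differentiableWithinAt hd]; simpa using hM0
  have hInt : ∀ a b : ℝ, IntervalIntegrable (fun u => ‖derivWithin p (Ici u) u‖)
      MeasureTheory.volume a b := by
    intro a b
    refine (intervalIntegrable_const (c := M)).mono_fun
      (stronglyMeasurable_derivWithin_Ici p).norm.aestronglyMeasurable ?_
    refine Eventually.of_forall fun u => ?_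
    simpa [abs_of_nonneg hM0] using hbd u
  rw [hσ, hσ, intervalIntegral.integral_interval_sub_left (hInt _ _) (hInt _ _)]
  refine (le_abs_self _).trans ?_
  rw [← Real.norm_eq_abs (∫ x in t'..t, _)]
  refine intervalIntegral.norm_integral_le_of_norm_le_const fun u _ => ?_
  rw [norm_norm]
  exact hbd u

/-- Let `a, b, s ∈ ℝ` be such that the natural parameterization `r` is differentiable at
`b` and `0 ≠ r b - r a = ‖r b - r a‖ • r s`, and write `r' b = x • r s + y • r'±(s)` with
`y ≠ 0`.  Then `y > 0` and the function `ν ε = ‖r (b+ε) - r a‖` has one-sided derivatives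
at `0` equal to `x - j(s)·y/(1 + ĵ(s))` (from the right) and `x + j(s)·y/(1 - ĵ(s))`
(from the left). -/
theorem natural_parameterization_asymptotic_formula
    {X : Type*} [NormedAddCommGroup X] [NormedSpace ℝ X] [CompleteSpace X]
    (hdim : Module.finrank ℝ X = 2)
    (e₁ e₂ : X) (hInd : LinearIndependent ℝ ![e₁, e₂])
    (p : ℝ → X)
    (hp : ∀ t, p t = ‖Real.cos t • e₁ + Real.sin t • e₂‖⁻¹ •
      (Real.cos t • e₁ + Real.sin t • e₂))
    (σ : ℝ → ℝ) (hσ : ∀ t, σ t = ∫ u in (0:ℝ)..t, ‖derivWithin p (Ici u) u‖)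
    (τ : ℝ → ℝ) (hτ_cont : Continuous τ) (hτ_mono : StrictMono τ)
    (hστ : ∀ x, σ (τ x) = x)
    (r : ℝ → X) (hr : ∀ s, r s = p (τ s))
    (a b s : ℝ)
    -- the one-sided derivatives of `r` at `s`
    (dm dp : X)
    (hdm : HasDerivWithinAt r dm (Iic s) s) (hdp : HasDerivWithinAt r dp (Ici s) s)
    -- the radial jump `j` and tangential jump `ĵ` at `s`
    (j jhat : ℝ)
    (hjj : (1/2 : ℝ) • (dp - dm) = j • r s + jhat • ((1/2 : ℝ) • (dp + dm)))
    -- `r` is differentiable at `b`, with derivative `rb = x • r s + y • r'±(s)`, `y ≠ 0`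
    (rb : X) (hb : HasDerivAt r rb b)
    (hne : r b - r a ≠ 0) (heq : r b - r a = ‖r b - r a‖ • r s)
    (x y : ℝ) (hxy : rb = x • r s + y • ((1/2 : ℝ) • (dp + dm))) (hy : y ≠ 0) :
    0 < y ∧
    HasDerivWithinAt (fun ε : ℝ => ‖r (b + ε) - r a‖) (x - j * y / (1 + jhat)) (Ici 0) 0 ∧
    HasDerivWithinAt (fun ε : ℝ => ‖r (b + ε) - r a‖) (x + j * y / (1 - jhat)) (Iic 0) 0 := by
  have hfin : FiniteDimensional ℝ X := Module.finite_of_finrank_eq_succ hdim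
  -- coordinates
  let B := basisOfLinearIndependentOfCardEqFinrank hInd (by simp [hdim])
  have hB0 : B 0 = e₁ := by simp [B]
  have hB1 : B 1 = e₂ := by simp [B]
  obtain ⟨φ, hφ⟩ : ∃ φ : X →L[ℝ] ℝ, ∀ z, φ z = B.repr z 0 :=
    ⟨LinearMap.toContinuousLinearMap (B.coord 0), fun z => rfl⟩
  obtain ⟨ψ, hψ⟩ : ∃ ψ : X →L[ℝ] ℝ, ∀ z, ψ z = B.repr z 1 :=
    ⟨LinearMap.toContinuousLinearMap (B.coord 1), fun z => rfl⟩
  have hφ1 : φ e₁ = 1 := by rw [hφ, ← hB0]; simp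
  have hφ2 : φ e₂ = 0 := by rw [hφ, ← hB1]; simp
  have hψ1 : ψ e₁ = 0 := by rw [hψ, ← hB0]; simp
  have hψ2 : ψ e₂ = 1 := by rw [hψ, ← hB1]; simp
  have hext : ∀ z w : X, φ z = φ w → ψ z = ψ w → z = w := by
    intro z w h1 h2
    refine B.ext_elem fun i => ?_
    fin_cases i
    · simpa [hφ] using h1
    · simpa [hψ] using h2
  clear_value B
  -- the circle
  obtain ⟨u, hu⟩ : ∃ u : ℝ → X, ∀ t, u t = Real.cos t • e₁ + Real.sin t • e₂ := ⟨_, fun t => rfl⟩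
  have hpu : ∀ t, p t = ‖u t‖⁻¹ • u t := fun t => by rw [hp, hu]
  have hφu : ∀ t, φ (u t) = Real.cos t := fun t => by simp [hu, hφ1, hφ2]
  have hψu : ∀ t, ψ (u t) = Real.sin t := fun t => by simp [hu, hψ1, hψ2]
  obtain ⟨K, hK0, hK⟩ : ∃ K : ℝ, 0 < K ∧ ∀ t, 1 ≤ K * ‖u t‖ := by
    refine ⟨‖φ‖ + ‖ψ‖ + 1, by positivity, fun t => ?_⟩
    have h1 := φ.le_opNorm (u t)
    have h2 := ψ.le_opNorm (u t)
    rw [hφu, Real.norm_eq_abs] at h1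
    rw [hψu, Real.norm_eq_abs] at h2
    have h3 := Real.sin_sq_add_cos_sq t
    have h4 := Real.abs_sin_le_one t
    have h5 := Real.abs_cos_le_one t
    have h6 : 1 ≤ |Real.cos t| + |Real.sin t| := by
      rw [← sq_abs (Real.sin t), ← sq_abs (Real.cos t)] at h3
      nlinarith [abs_nonneg (Real.sin t), abs_nonneg (Real.cos t)]
    nlinarith [norm_nonneg (u t)]
  obtain ⟨L, hL0, hLb, hL⟩ : ∃ L : ℝ, 0 < L ∧ (∀ t, ‖u t‖ ≤ L) ∧
      ∀ t t', ‖u t - u t'‖ ≤ L * |t - t'| := by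
    refine ⟨‖e₁‖ + ‖e₂‖ + 1, by positivity, fun t => ?_, fun t t' => ?_⟩
    · rw [hu]
      refine (norm_add_le _ _).trans ?_
      rw [norm_smul, norm_smul, Real.norm_eq_abs, Real.norm_eq_abs]
      nlinarith [Real.abs_sin_le_one t, Real.abs_cos_le_one t, norm_nonneg e₁, norm_nonneg e₂]
    · have : u t - u t' = (Real.cos t - Real.cos t') • e₁ + (Real.sin t - Real.sin t') • e₂ := by
        rw [hu, hu]; module
      rw [this]
      refine (norm_add_le _ _).trans ?_
      rw [norm_smul, norm_smul, Real.norm_eq_abs, Real.norm_eq_abs]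
      nlinarith [Real.abs_sin_sub_sin_le t t', Real.abs_cos_sub_cos_le t t', norm_nonneg e₁,
        norm_nonneg e₂, abs_nonneg (t - t')]
  have hupos : ∀ t, 0 < ‖u t‖ := fun t => by
    by_contra h
    have := hK t
    nlinarith [norm_nonneg (u t)]
  obtain ⟨M, hM0, hM⟩ : ∃ M : ℝ, 0 < M ∧ ∀ t t', ‖p t - p t'‖ ≤ M * |t - t'| :=
    ⟨2 * K * L, by positivity, fun t t' => by
      rw [hpu, hpu]; exact aux_p_lip hL hK0 hK t t'⟩
  have hστ' : ∀ h₁ h₂ : ℝ, h₂ - h₁ ≤ M * |τ h₂ - τ h₁| := fun h₁ h₂ => by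
    have := aux_sigma hM0.le hM hσ (τ h₂) (τ h₁)
    rwa [hστ, hστ] at this
  have hr1 : ∀ t, ‖r t‖ = 1 := fun t => by
    rw [hr, hpu, norm_smul, norm_inv, norm_norm, inv_mul_cancel₀ (hupos _).ne']
  -- the determinant
  obtain ⟨D, hD⟩ : ∃ D : X → X →L[ℝ] ℝ, ∀ z w, D z w = φ z * ψ w - ψ z * φ w :=
    ⟨fun z => φ z • ψ - ψ z • φ, fun z w => by simp⟩
  have hDr : ∀ h₁ h₂, D (r h₁) (r h₂) =
      ‖u (τ h₁)‖⁻¹ * ‖u (τ h₂)‖⁻¹ * Real.sin (τ h₂ - τ h₁) := fun h₁ h₂ => by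
    rw [hD, hr, hr, hpu, hpu]
    simp only [map_smul, hφu, hψu, smul_eq_mul, Real.sin_sub]
    ring
  obtain ⟨κ, hκ0, hκ⟩ : ∃ κ : ℝ, 0 < κ ∧ ∀ h₁ h₂, h₁ < h₂ → τ h₂ - τ h₁ ≤ Real.pi / 2 →
      κ * (h₂ - h₁) ≤ D (r h₁) (r h₂) := by
    refine ⟨L⁻¹ * L⁻¹ * (2 / Real.pi * M⁻¹), by positivity, fun h₁ h₂ hlt hle => ?_⟩
    have hτ : 0 < τ h₂ - τ h₁ := sub_pos.2 (hτ_mono hlt)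
    have h1 := Real.mul_le_sin hτ.le hle
    have h2 := hστ' h₁ h₂
    rw [abs_of_pos hτ, ← inv_mul_le_iff₀ hM0] at h2
    rw [hDr]
    have hi : ∀ t, L⁻¹ ≤ ‖u t‖⁻¹ := fun t => inv_anti₀ (hupos t) (hLb t)
    have h3 : 2 / Real.pi * (M⁻¹ * (h₂ - h₁)) ≤ Real.sin (τ h₂ - τ h₁) :=
      le_trans (by gcongr) h1
    have h4 : L⁻¹ * L⁻¹ ≤ ‖u (τ h₁)‖⁻¹ * ‖u (τ h₂)‖⁻¹ :=
      mul_le_mul (hi _) (hi _) (by positivity) (by positivity)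
    have h5 : 0 < h₂ - h₁ := sub_pos.2 hlt
    calc _ = L⁻¹ * L⁻¹ * (2 / Real.pi * (M⁻¹ * (h₂ - h₁))) := by ring
      _ ≤ _ := by gcongr
  have hslope : ∀ s₀, ∀ᶠ h in 𝓝[≠] s₀, κ ≤ D (r s₀) (slope r s₀ h) := by
    intro s₀
    have hpi := Real.pi_pos
    have hev : ∀ᶠ h in 𝓝 s₀, |τ h - τ s₀| < Real.pi / 2 := by
      have hc : Continuous fun h => |τ h - τ s₀| := by fun_prop
      exact hc.continuousAt.eventually_lt_const (by simpa using hpi)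
    filter_upwards [nhdsWithin_le_nhds hev, self_mem_nhdsWithin] with h hh hne'
    have e1 : D (r s₀) (slope r s₀ h) = (h - s₀)⁻¹ * D (r s₀) (r h) := by
      rw [slope_def_module, map_smul, map_sub, smul_eq_mul]
      have : D (r s₀) (r s₀) = 0 := by rw [hD]; ring
      rw [this, sub_zero]
    rw [e1]
    rw [abs_lt] at hh
    rcases lt_or_gt_of_ne hne' with hlt | hlt
    · have h1 := hκ h s₀ hlt (by linarith)
      have h2 : D (r s₀) (r h) = - D (r h) (r s₀) := by rw [hD, hD]; ring
      have h3 : (h - s₀)⁻¹ * D (r s₀) (r h) = (s₀ - h)⁻¹ * D (r h) (r s₀) := by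
        rw [h2, ← neg_sub s₀ h, inv_neg]; ring
      rw [h3, le_inv_mul_iff₀ (sub_pos.2 hlt)]
      linarith
    · have h1 := hκ s₀ h hlt (by linarith)
      rw [le_inv_mul_iff₀ (sub_pos.2 hlt)]
      linarith
  have hDp : 0 < D (r s) dp := by
    have h := hasDerivWithinAt_iff_tendsto_slope.1 hdp
    rw [Ici_sdiff_left] at h
    refine hκ0.trans_le (ge_of_tendsto (((D (r s)).continuous.tendsto _).comp h) ?_)
    exact (hslope s).filter_mono (nhdsWithin_mono _ fun z hz => ne_of_gt hz)
  have hDm : 0 < D (r s) dm := by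
    have h := hasDerivWithinAt_iff_tendsto_slope.1 hdm
    rw [Iic_sdiff_right] at h
    refine hκ0.trans_le (ge_of_tendsto (((D (r s)).continuous.tendsto _).comp h) ?_)
    exact (hslope s).filter_mono (nhdsWithin_mono _ fun z hz => ne_of_lt hz)
  have hDb : 0 < D (r b) rb := by
    have h := hasDerivAt_iff_tendsto_slope.1 hb
    exact hκ0.trans_le (ge_of_tendsto (((D (r b)).continuous.tendsto _).comp h) (hslope b))
  have hDss : D (r s) (r s) = 0 := by rw [hD]; ring
  obtain ⟨w, hw⟩ : ∃ w : X, w = (1/2 : ℝ) • (dp + dm) := ⟨_, rfl⟩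
  rw [← hw] at hjj hxy
  have hdpw : dp = (1 + jhat) • w + j • r s := by
    have : dp = w + (1/2 : ℝ) • (dp - dm) := by rw [hw]; module
    rw [this, hjj]; module
  have hdmw : dm = (1 - jhat) • w - j • r s := by
    have : dm = w - (1/2 : ℝ) • (dp - dm) := by rw [hw]; module
    rw [this, hjj]; module
  have hDw : 0 < D (r s) w := by
    rw [hw, map_smul, map_add, smul_eq_mul]; linarith
  have hj1 : 0 < 1 + jhat := by
    rw [hdpw, map_add, map_smul, map_smul, hDss] at hDp
    simp only [smul_eq_mul, mul_zero, add_zero] at hDp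
    exact pos_of_mul_pos_left hDp hDw.le
  have hj2 : 0 < 1 - jhat := by
    rw [hdmw, map_sub, map_smul, map_smul, hDss] at hDm
    simp only [smul_eq_mul, mul_zero, sub_zero] at hDm
    exact pos_of_mul_pos_left hDm hDw.le
  obtain ⟨c, hcdef⟩ : ∃ c : ℝ, c = ‖r b - r a‖ := ⟨_, rfl⟩
  have hc : 0 < c := by rw [hcdef]; exact norm_pos_iff.2 hne
  rw [← hcdef] at heq
  -- the supporting line at `r b`
  have hsupp : D (r a) rb ≤ D (r b) rb := by
    by_contra hcon
    push Not at hcon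
    have hpos : 0 < D (r a) rb := hDb.trans hcon
    have e : D (r b) rb • r a =
        D (r a) rb • (r b + (D (r b) (r a) / D (r a) rb) • rb) := by
      rw [smul_add, smul_smul, mul_div_cancel₀ _ hpos.ne']
      apply hext
      · simp only [map_add, map_smul, smul_eq_mul, hD]; ring
      · simp only [map_add, map_smul, smul_eq_mul, hD]; ring
    have h1 := congrArg norm e
    rw [norm_smul, norm_smul, hr1, Real.norm_of_nonneg hDb.le, Real.norm_of_nonneg hpos.le] at h1
    have h2 := aux_min hr1 hb (D (r b) (r a) / D (r a) rb)
    nlinarith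
  have hy0 : 0 < y := by
    refine lt_of_le_of_ne ?_ hy.symm
    have h1 : D (r b) rb - D (r a) rb = c * D (r s) rb := by
      have hh1 : φ (r b) - φ (r a) = c * φ (r s) := by rw [← map_sub, heq, map_smul, smul_eq_mul]
      have hh2 : ψ (r b) - ψ (r a) = c * ψ (r s) := by rw [← map_sub, heq, map_smul, smul_eq_mul]
      rw [hD, hD, hD]
      linear_combination ψ rb * hh1 - φ rb * hh2
    have h2 : D (r s) rb = y * D (r s) w := by
      rw [hxy, map_add, map_smul, map_smul, hDss]; simp
    have h3 : 0 ≤ c * (y * D (r s) w) := by rw [← h2, ← h1]; linarith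
    exact nonneg_of_mul_nonneg_left (nonneg_of_mul_nonneg_right h3 hc) hDw
  have hg : HasDerivAt (fun ε : ℝ => r (b + ε) - r a) rb 0 := by
    have : HasDerivAt r rb (b + 0) := by simpa using hb
    exact (this.comp_const_add b 0).sub_const (r a)
  refine ⟨hy0, ?_, ?_⟩
  · have e : rb = (x - j * y / (1 + jhat)) • r s + (y / (1 + jhat)) • dp := by
      rw [hxy, hdpw, smul_add, smul_smul, smul_smul, div_mul_cancel₀ _ hj1.ne']
      module
    refine aux_onesided (T := Ici s) (c := c) (B := y / (1 + jhat)) hr1 hdp hc (by simpa using heq)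
      ?_ (by rw [← e]; exact hg.hasDerivWithinAt)
    intro t ht
    have ht' : 0 ≤ t := ht
    have : 0 ≤ y / (1 + jhat) / c * t := by positivity
    simpa using this
  · have e : rb = (x + j * y / (1 - jhat)) • r s + (y / (1 - jhat)) • dm := by
      rw [hxy, hdmw, smul_sub, smul_smul, smul_smul, div_mul_cancel₀ _ hj2.ne']
      module
    refine aux_onesided (T := Iic s) (c := c) (B := y / (1 - jhat)) hr1 hdm hc (by simpa using heq)
      ?_ (by rw [← e]; exact hg.hasDerivWithinAt)
    intro t ht
    have ht' : t ≤ 0 := ht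
    have : y / (1 - jhat) / c * t ≤ 0 := mul_nonpos_of_nonneg_of_nonpos (by positivity) ht'
    simpa using this
end

section
/- Let X be a strictly convex 2-dimensional real Banach space and let a, b, c ∈ S_X be points such that b is a smooth point of S_X and 0 ≠ b − a = ‖b − a‖·c. Then the point c is non-smooth if and only if there exist positive real numbers δ and ε₀ such that for every 0 < ε < ε₀ there are two distinct points x, y ∈ S_X with ‖x − b‖ = ε = ‖y − b‖ and ‖x − a‖ + ‖y − a‖ > 2·‖b − a‖ + δ·ε. -/
open Metric Set

/-- A point `x` of the unit sphere of `X` is *smooth* if there is a unique continuous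
linear functional `g : X →L[ℝ] ℝ` with `g x = 1 = ‖g‖`. -/
def IsSmoothPoint {X : Type*} [NormedAddCommGroup X] [NormedSpace ℝ X] (x : X) : Prop :=
  ∃! g : X →L[ℝ] ℝ, g x = 1 ∧ ‖g‖ = 1

/-- A real Banach space is *strictly convex* if every convex subset of its unit sphere
contains at most one point. -/
def StrictlyConvexSphere (X : Type*) [NormedAddCommGroup X] [NormedSpace ℝ X] : Prop :=
  ∀ s : Set X, s ⊆ sphere (0 : X) 1 → Convex ℝ s → s.Subsingleton

section aux
variable {X : Type*} [NormedAddCommGroup X] [NormedSpace ℝ X]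

lemma aux_strict (hsc : StrictlyConvexSphere X) : StrictConvexSpace ℝ X := by
  refine StrictConvexSpace.of_norm_combo_lt_one ?_
  intro x y hx hy hxy
  by_contra hcon
  push Not at hcon
  apply hxy
  refine hsc (segment ℝ x y) ?_ (convex_segment x y) (left_mem_segment ℝ x y)
    (right_mem_segment ℝ x y)
  rintro z ⟨p, q, hp, hq, hpq, rfl⟩
  rw [mem_sphere_zero_iff_norm]
  refine le_antisymm ?_ (hcon p q hpq)
  calc ‖p • x + q • y‖ ≤ ‖p • x‖ + ‖q • y‖ := norm_add_le _ _
    _ = 1 := by rw [norm_smul, norm_smul, hx, hy, Real.norm_of_nonneg hp, Real.norm_of_nonneg hq]; linarith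

lemma aux_bound (g : X →L[ℝ] ℝ) (hg : ‖g‖ ≤ 1) (x : X) : |g x| ≤ ‖x‖ := by
  have := g.le_of_opNorm_le hg x
  simpa using this

/-- continuity of the support functional at a smooth point -/
lemma aux_smooth [FiniteDimensional ℝ X] {b : X} (hb : ‖b‖ = 1) {f : X →L[ℝ] ℝ}
    (huniq : ∀ g : X →L[ℝ] ℝ, g b = 1 ∧ ‖g‖ = 1 → g = f) {η : ℝ} (hη : 0 < η) :
    ∃ ρ > (0:ℝ), ∀ (x : X) (g : X →L[ℝ] ℝ), ‖g‖ ≤ 1 → g x = ‖x‖ → ‖x - b‖ < ρ → ‖g - f‖ < η := by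
  let K : Set (X →L[ℝ] ℝ) := closedBall 0 1 ∩ {g | η ≤ ‖g - f‖}
  have hK : IsCompact K := by
    have : ProperSpace (X →L[ℝ] ℝ) := FiniteDimensional.proper ℝ _
    refine (isCompact_closedBall _ _).inter_right ?_
    exact isClosed_le continuous_const (by fun_prop)
  have hpos : ∀ g ∈ K, 0 < 1 - g b := by
    rintro g ⟨h1, h2⟩
    have h1 : ‖g‖ ≤ 1 := by simpa using h1
    have h3 := (abs_le.1 (aux_bound g h1 b)).2
    rw [hb] at h3
    rcases h3.lt_or_eq with h | h
    · linarith
    · exfalso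
      have h4 : ‖g‖ = 1 := by
        refine le_antisymm h1 ?_
        have := g.le_opNorm b
        rw [h, hb] at this
        simpa using this
      have h5 : η ≤ ‖g - f‖ := h2
      rw [huniq g ⟨h, h4⟩] at h5
      simp at h5
      linarith
  have hm : ∃ m > (0:ℝ), ∀ g ∈ K, m ≤ 1 - g b := by
    rcases K.eq_empty_or_nonempty with h | h
    · exact ⟨1, one_pos, by simp [h]⟩
    · obtain ⟨g0, hg0, hmin⟩ := hK.exists_isMinOn h (f := fun g : X →L[ℝ] ℝ => 1 - g b)
        (by fun_prop)
      exact ⟨_, hpos g0 hg0, fun g hg => hmin hg⟩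
  obtain ⟨m, hm0, hm⟩ := hm
  refine ⟨m / 2, by positivity, fun x g hg hgx hxb => ?_⟩
  by_contra hcon
  push Not at hcon
  have h1 := hm g ⟨by simpa using hg, hcon⟩
  have h2 := (abs_le.1 (aux_bound g hg (x - b))).2
  have h3 : ‖b‖ - ‖x‖ ≤ ‖x - b‖ := by rw [norm_sub_rev]; exact norm_sub_norm_le _ _
  rw [map_sub] at h2
  linarith

/-- support functionals exist -/
lemma aux_support (x : X) : ∃ g : X →L[ℝ] ℝ, ‖g‖ ≤ 1 ∧ g x = ‖x‖ := by
  obtain ⟨g, h1, h2⟩ := exists_dual_vector'' ℝ x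
  exact ⟨g, h1, by simpa using h2⟩

/-- monotonicity lemma, strict form -/
lemma aux_mono [StrictConvexSpace ℝ X] {b x y : X} (hb : ‖b‖ = 1) (hx : ‖x‖ = 1) (hy : ‖y‖ = 1)
    (hxy : x ≠ y) {l m : ℝ} (hl : 0 ≤ l) (hm : 0 ≤ m) (h : y = l • b + m • x) :
    ‖y - b‖ ≠ ‖x - b‖ := by
  intro hE
  have hlm : 1 ≤ l + m := by
    calc (1:ℝ) = ‖l • b + m • x‖ := by rw [← h, hy]
      _ ≤ ‖l • b‖ + ‖m • x‖ := norm_add_le _ _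
      _ = l + m := by
        rw [norm_smul, norm_smul, hx, hb, Real.norm_of_nonneg hl, Real.norm_of_nonneg hm]; ring
  have h0 : 0 < l + m := by linarith
  obtain ⟨k, hk⟩ : ∃ k, k = (l + m)⁻¹ := ⟨_, rfl⟩
  have hk0 : 0 < k := by rw [hk]; positivity
  have hk1 : k ≤ 1 := by rw [hk]; exact inv_le_one_of_one_le₀ hlm
  have hkk : k * (l + m) = 1 := by rw [hk]; exact inv_mul_cancel₀ h0.ne'
  have hwx : k • y - x = (k * l) • (b - x) := by
    rw [h]
    have : (k * l) = 1 - k * m := by linarith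
    rw [smul_add, smul_smul, smul_smul, smul_sub, this]
    module
  have hwb : k • y - b = (k * m) • (x - b) := by
    rw [h]
    have : (k * l) = 1 - k * m := by linarith
    rw [smul_add, smul_smul, smul_smul, smul_sub, this]
    module
  have n1 : ‖k • y - x‖ = k * l * ‖x - b‖ := by
    rw [hwx, norm_smul, Real.norm_of_nonneg (by positivity), norm_sub_rev]
  have n2 : ‖k • y - b‖ = k * m * ‖x - b‖ := by
    rw [hwb, norm_smul, Real.norm_of_nonneg (by positivity)]
  have n3 : ‖k • y‖ = k := by rw [norm_smul, hy, Real.norm_of_nonneg hk0.le, mul_one]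
  have n4 : ‖y - k • y‖ = 1 - k := by
    have : y - k • y = (1 - k) • y := by module
    rw [this, norm_smul, hy, Real.norm_of_nonneg (by linarith), mul_one]
  have t3 : dist 0 (k • y) + dist (k • y) x = dist 0 x := by
    refine le_antisymm ?_ (dist_triangle _ _ _)
    rw [dist_zero_left, dist_zero_left, dist_eq_norm, hx, n1, n3]
    have h5 := norm_sub_le_norm_sub_add_norm_sub y (k • y) b
    have : k * m * ‖x - b‖ + k * l * ‖x - b‖ = ‖x - b‖ := by
      rw [← add_mul, show k * m + k * l = 1 by linarith, one_mul]
    linarith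
  rw [dist_add_dist_eq_iff] at t3
  obtain ⟨τ, ⟨hτ, -⟩, hτx⟩ := t3
  have hτx : τ • x = k • y := by simpa [AffineMap.lineMap_apply] using hτx
  have hτk : τ = k := by
    have := congrArg norm hτx
    rwa [n3, norm_smul, hx, Real.norm_of_nonneg hτ, mul_one] at this
  rw [hτk] at hτx
  exact hxy (smul_right_injective X hk0.ne' hτx)

/-- estimates of the coordinates of a point of the sphere near `b` -/
lemma aux_est {b v x : X} {f : X →L[ℝ] ℝ} (hb : ‖b‖ = 1) (hv : ‖v‖ = 1) (hfb : f b = 1)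
    (hf : ‖f‖ ≤ 1) {η ρ : ℝ}
    (hρ : ∀ (x : X) (g : X →L[ℝ] ℝ), ‖g‖ ≤ 1 → g x = ‖x‖ → ‖x - b‖ < ρ → ‖g - f‖ < η)
    (hx : ‖x‖ = 1) (hxb : ‖x - b‖ < ρ) {s : ℝ} (hs : x = f x • b + s • v) :
    0 ≤ 1 - f x ∧ 1 - f x ≤ η * ‖x - b‖ ∧ |(|s| - ‖x - b‖)| ≤ η * ‖x - b‖ := by
  obtain ⟨g, hg, hgx⟩ := aux_support x
  have h1 := hρ x g hg hgx hxb
  have h2 := (abs_le.1 (aux_bound f hf x)).2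
  have h3 := (abs_le.1 (aux_bound g hg b)).2
  have h4 := (abs_le.1 ((g - f).le_of_opNorm_le h1.le (x - b))).2
  simp only [sub_apply, map_sub] at h4
  have h5 : 0 ≤ 1 - f x := by linarith
  have h6 : 1 - f x ≤ η * ‖x - b‖ := by linarith
  refine ⟨h5, h6, ?_⟩
  have h7 := abs_norm_sub_norm_le (s • v) (x - b)
  have h8 : s • v - (x - b) = (1 - f x) • b := by
    have : s • v = x - f x • b := by rw [eq_sub_iff_add_eq, add_comm]; exact hs.symm
    rw [this]; module
  rw [h8, norm_smul, norm_smul, hb, hv, Real.norm_of_nonneg h5] at h7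
  simp only [Real.norm_eq_abs, mul_one] at h7
  linarith

/-- existence of a point at given distance -/
lemma aux_exists {b v : X} {f : X →L[ℝ] ℝ} (hb : ‖b‖ = 1) (hv : ‖v‖ = 1) (hfb : f b = 1)
    (hfv : f v = 0) {ε : ℝ} (hε : 0 < ε) (hε' : ε < ‖v - b‖) :
    ∃ x : X, ‖x‖ = 1 ∧ ‖x - b‖ = ε ∧ ∃ s > (0:ℝ), x = f x • b + s • v := by
  let z : ℝ → X := fun θ => (1 - θ) • b + θ • v
  have hfz : ∀ θ, f (z θ) = 1 - θ := fun θ => by simp [z, hfb, hfv]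
  have hz : ∀ θ, z θ ≠ 0 := by
    intro θ h0
    have h1 := hfz θ
    rw [h0, map_zero] at h1
    have : θ = 1 := by linarith
    subst this
    simp [z] at h0
    simp [h0] at hv
  have hzc : Continuous z := by fun_prop
  have hcont : Continuous fun θ => ‖(‖z θ‖⁻¹ • z θ) - b‖ := by
    have : Continuous fun θ => ‖z θ‖⁻¹ := hzc.norm.inv₀ fun θ => norm_ne_zero_iff.2 (hz θ)
    fun_prop
  have hivt := intermediate_value_Icc (zero_le_one' ℝ) hcont.continuousOn
  obtain ⟨θ, ⟨hθ0, hθ1⟩, hθ⟩ := hivt (show ε ∈ _ by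
    constructor
    · simp [z, hb]; exact hε.le
    · simp [z, hv]; exact hε'.le)
  have hnz : 0 < ‖z θ‖ := norm_pos_iff.2 (hz θ)
  have hθpos : 0 < θ := by
    rcases hθ0.lt_or_eq with h | h
    · exact h
    · subst h
      simp [z, hb] at hθ
      linarith
  refine ⟨‖z θ‖⁻¹ • z θ, ?_, hθ, ‖z θ‖⁻¹ * θ, by positivity, ?_⟩
  · rw [norm_smul, norm_inv, norm_norm, inv_mul_cancel₀ hnz.ne']
  · rw [map_smul, hfz, smul_eq_mul, mul_smul, mul_smul, ← smul_add]

lemma aux_coord (hdim : Module.finrank ℝ X = 2) {b : X} {f : X →L[ℝ] ℝ} (hfb : f b = 1) :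
    ∃ v : X, ‖v‖ = 1 ∧ f v = 0 ∧ ∀ x, ∃ s : ℝ, x = f x • b + s • v := by
  have : FiniteDimensional ℝ X := Module.finite_of_finrank_eq_succ hdim
  have hf0 : (f : X →ₗ[ℝ] ℝ) ≠ 0 := by
    intro h
    have := LinearMap.congr_fun h b
    simp [hfb] at this
  have h1 := Module.Dual.finrank_ker_add_one_of_ne_zero (f := (f : X →ₗ[ℝ] ℝ)) hf0
  have h2 : Module.finrank ℝ (LinearMap.ker (f : X →ₗ[ℝ] ℝ)) = 1 := by omega
  obtain ⟨w, hw0, hw⟩ := finrank_eq_one_iff'.1 h2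
  have hw0' : (w : X) ≠ 0 := by simpa using hw0
  have hn : ‖(w : X)‖ ≠ 0 := norm_ne_zero_iff.2 hw0'
  have hfw : f (w : X) = 0 := w.2
  refine ⟨‖(w : X)‖⁻¹ • (w : X), ?_, ?_, ?_⟩
  · rw [norm_smul, norm_inv, norm_norm, inv_mul_cancel₀ hn]
  · rw [map_smul, hfw, smul_zero]
  · intro x
    obtain ⟨t, ht⟩ := hw ⟨x - f x • b, by simp [hfb]⟩
    have ht' : t • (w : X) = x - f x • b := congrArg Subtype.val ht
    refine ⟨t * ‖(w : X)‖, ?_⟩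
    rw [smul_smul, mul_assoc, mul_inv_cancel₀ hn, mul_one, ht']
    abel

/-- two distinct points of the sphere at the same distance from `b` lie on opposite sides -/
lemma aux_opp [StrictConvexSpace ℝ X] {b v x y : X} {p q s t : ℝ} (hb : ‖b‖ = 1)
    (hx : ‖x‖ = 1) (hy : ‖y‖ = 1) (hxy : x ≠ y)
    (hE : ‖x - b‖ = ‖y - b‖)
    (hxs : x = p • b + s • v) (hyt : y = q • b + t • v) : s * t ≤ 0 := by
  by_contra hst
  push Not at hst
  have hs : s ≠ 0 := by rintro rfl; simp at hst
  have ht : t ≠ 0 := by rintro rfl; simp at hst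
  have h1 : 0 < t / s := by
    have : t / s = s * t / s ^ 2 := by field_simp
    rw [this]; positivity
  have h2 : 0 < s / t := by
    have : s / t = s * t / t ^ 2 := by field_simp
    rw [this]; positivity
  have e1 : y = (q - p * (t / s)) • b + (t / s) • x := by
    rw [hxs, smul_add, smul_smul, smul_smul, div_mul_cancel₀ _ hs, hyt]
    module
  have e2 : x = (p - q * (s / t)) • b + (s / t) • y := by
    rw [hyt, smul_add, smul_smul, smul_smul, div_mul_cancel₀ _ ht, hxs]
    module
  rcases le_total 0 (q - p * (t / s)) with h | h
  · exact aux_mono hb hx hy hxy h h1.le e1 hE.symm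
  · refine aux_mono hb hy hx hxy.symm ?_ h2.le e2 hE
    have : p - q * (s / t) = -(q - p * (t / s)) * (s / t) := by field_simp; ring
    rw [this]
    exact mul_nonneg (by linarith) h2.le

lemma aux_upper {c h z : X} {r ρ η : ℝ} {f : X →L[ℝ] ℝ} (hr : 0 < r) (hc : ‖c‖ = 1)
    (hρ : ∀ (x : X) (g : X →L[ℝ] ℝ), ‖g‖ ≤ 1 → g x = ‖x‖ → ‖x - c‖ < ρ → ‖g - f‖ < η)
    (hz : z = r • c + h) (hh : ‖h‖ < r * ρ) : ‖z‖ ≤ r + f h + η * ‖h‖ := by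
  obtain ⟨g, hg, hgz⟩ := aux_support z
  have h1 : ‖g - f‖ < η := by
    refine hρ (r⁻¹ • z) g hg ?_ ?_
    · rw [map_smul, hgz, norm_smul, norm_inv, Real.norm_of_nonneg hr.le, smul_eq_mul]
    · have : r⁻¹ • z - c = r⁻¹ • h := by
        rw [hz, smul_add, smul_smul, inv_mul_cancel₀ hr.ne']; module
      rw [this, norm_smul, norm_inv, Real.norm_of_nonneg hr.le]
      rw [inv_mul_lt_iff₀ hr]
      exact hh
  have h2 := (abs_le.1 ((g - f).le_of_opNorm_le h1.le h)).2
  have h3 := (abs_le.1 (aux_bound g hg c)).2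
  simp only [sub_apply] at h2
  rw [← hgz]
  have h4 : g z = r * g c + g h := by rw [hz, map_add, map_smul, smul_eq_mul]
  rw [hc] at h3
  have h5 : r * g c ≤ r * 1 := mul_le_mul_of_nonneg_left h3 hr.le
  linarith

lemma aux_forward [FiniteDimensional ℝ X] {a b c v : X} {r : ℝ} {f g₁ g₂ : X →L[ℝ] ℝ}
    (hb : ‖b‖ = 1) (hv : ‖v‖ = 1) (hfb : f b = 1) (hf : ‖f‖ ≤ 1) (hfv : f v = 0)
    (huniq : ∀ g : X →L[ℝ] ℝ, g b = 1 ∧ ‖g‖ = 1 → g = f)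
    (hba : b - a = r • c) (hg₁ : ‖g₁‖ ≤ 1) (hg₂ : ‖g₂‖ ≤ 1) (h₁ : g₁ c = 1) (h₂ : g₂ c = 1)
    (hlt : g₂ v < g₁ v) :
    ∃ δ > (0:ℝ), ∃ ε₀ > (0:ℝ), ∀ ε : ℝ, 0 < ε → ε < ε₀ →
        ∃ x ∈ sphere (0 : X) 1, ∃ y ∈ sphere (0 : X) 1, x ≠ y ∧
          ‖x - b‖ = ε ∧ ‖y - b‖ = ε ∧
          ‖x - a‖ + ‖y - a‖ > 2 * r + δ * ε := by
  obtain ⟨d, hd⟩ : ∃ d, d = g₁ v - g₂ v := ⟨_, rfl⟩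
  have hd0 : 0 < d := by linarith
  obtain ⟨ρ, hρ0, hρ⟩ := aux_smooth hb huniq (η := d / 8) (by positivity)
  have hvb : 0 < ‖v - b‖ := by
    rw [norm_pos_iff, sub_ne_zero]; rintro rfl; linarith
  have hvb' : 0 < ‖-v - b‖ := by
    rw [norm_pos_iff, sub_ne_zero]; rintro rfl
    rw [map_neg] at hfb; linarith
  refine ⟨d / 4, by positivity, min ρ (min ‖v - b‖ ‖-v - b‖), by positivity, fun ε hε hε' => ?_⟩
  have e1 : ε < ρ := lt_of_lt_of_le hε' (min_le_left _ _)
  have e2 : ε < ‖v - b‖ := lt_of_lt_of_le hε' ((min_le_right _ _).trans (min_le_left _ _))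
  have e3 : ε < ‖-v - b‖ := lt_of_lt_of_le hε' ((min_le_right _ _).trans (min_le_right _ _))
  have hv' : ‖-v‖ = 1 := by rw [norm_neg, hv]
  obtain ⟨x, hx, hxb, s, hs, hxs⟩ := aux_exists hb hv hfb hfv hε e2
  obtain ⟨y, hy, hyb, t, ht, hyt⟩ := aux_exists hb hv' hfb (by rw [map_neg, hfv, neg_zero]) hε e3
  obtain ⟨p0, p1, p2⟩ := aux_est hb hv hfb hf hρ hx (by rw [hxb]; exact e1) hxs
  obtain ⟨q0, q1, q2⟩ := aux_est hb hv' hfb hf hρ hy (by rw [hyb]; exact e1) hyt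
  rw [hxb] at p1 p2
  rw [hyb] at q1 q2
  rw [abs_of_pos hs] at p2
  rw [abs_of_pos ht] at q2
  refine ⟨x, by simpa using hx, y, by simpa using hy, ?_, hxb, hyb, ?_⟩
  · rintro rfl
    have h3 : (s + t) • v = 0 := by
      have : f x • b + s • v = f x • b + t • -v := by rw [← hxs, ← hyt]
      have := add_left_cancel this
      rw [add_smul, this, smul_neg]; simp
    rw [smul_eq_zero] at h3
    rcases h3 with h3 | h3
    · linarith
    · rw [h3] at hv; simp at hv
  · have key : ∀ (g : X →L[ℝ] ℝ) (z w : X) (σ : ℝ), ‖g‖ ≤ 1 → g c = 1 → ‖w‖ = 1 →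
        z = f z • b + σ • w → 0 ≤ 1 - f z → 1 - f z ≤ d / 8 * ε → |σ - ε| ≤ d / 8 * ε →
        r + ε * g w - 2 * (d / 8 * ε) ≤ ‖z - a‖ := by
      intro g z w σ hg hgc hw hz hz0 hz1 hσ
      have k1 := (abs_le.1 (aux_bound g hg (z - a))).2
      have k2 := (abs_le.1 (aux_bound g hg b)).2
      have k3 := aux_bound g hg w
      rw [hb] at k2
      rw [hw] at k3
      have k4 : z - a = r • c + σ • w - (1 - f z) • b := by
        rw [← hba]
        have : σ • w = z - f z • b := by rw [eq_sub_iff_add_eq, add_comm]; exact hz.symm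
        rw [this]; module
      have k5 : g (z - a) = r + σ * g w - (1 - f z) * g b := by
        rw [k4]; simp [hgc]
      have k6 : (1 - f z) * g b ≤ (1 - f z) * 1 := mul_le_mul_of_nonneg_left k2 hz0
      have k7 : |(σ - ε) * g w| ≤ d / 8 * ε * 1 := by
        rw [abs_mul]
        exact mul_le_mul hσ k3 (abs_nonneg _) (by positivity)
      have k8 := (abs_le.1 k7).1
      have k9 : (σ - ε) * g w = σ * g w - ε * g w := by ring
      linarith
    have a1 := key g₁ x v s hg₁ h₁ hv hxs p0 p1 p2
    have a2 := key g₂ y (-v) t hg₂ h₂ hv' hyt q0 q1 q2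
    rw [map_neg] at a2
    have a3 : ε * g₁ v + ε * -g₂ v = d * ε := by rw [hd]; ring
    have a4 : 0 < d * ε := by positivity
    linarith

lemma aux_backward [FiniteDimensional ℝ X] [StrictConvexSpace ℝ X] {a b c v : X} {r : ℝ}
    {f fc : X →L[ℝ] ℝ} (hr : 0 < r)
    (hb : ‖b‖ = 1) (hc : ‖c‖ = 1) (hv : ‖v‖ = 1) (hfb : f b = 1) (hf : ‖f‖ ≤ 1)
    (hcoord : ∀ x, ∃ s : ℝ, x = f x • b + s • v)
    (huniq : ∀ g : X →L[ℝ] ℝ, g b = 1 ∧ ‖g‖ = 1 → g = f) (hfc : ‖fc‖ ≤ 1)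
    (huniqc : ∀ g : X →L[ℝ] ℝ, g c = 1 ∧ ‖g‖ = 1 → g = fc)
    (hba : b - a = r • c) {δ ε₀ : ℝ} (hδ : 0 < δ) (hε₀ : 0 < ε₀)
    (H : ∀ ε : ℝ, 0 < ε → ε < ε₀ →
        ∃ x ∈ sphere (0 : X) 1, ∃ y ∈ sphere (0 : X) 1, x ≠ y ∧
          ‖x - b‖ = ε ∧ ‖y - b‖ = ε ∧
          ‖x - a‖ + ‖y - a‖ > 2 * r + δ * ε) : False := by
  obtain ⟨ρ, hρ0, hρ⟩ := aux_smooth hb huniq (η := δ / 6) (by positivity)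
  obtain ⟨ρc, hρc0, hρc⟩ := aux_smooth hc huniqc (η := δ / 6) (by positivity)
  obtain ⟨ε, hε, hε'⟩ := exists_between (show 0 < min ε₀ (min ρ (r * ρc)) by positivity)
  have e1 : ε < ε₀ := lt_of_lt_of_le hε' (min_le_left _ _)
  have e2 : ε < ρ := lt_of_lt_of_le hε' ((min_le_right _ _).trans (min_le_left _ _))
  have e3 : ε < r * ρc := lt_of_lt_of_le hε' ((min_le_right _ _).trans (min_le_right _ _))
  obtain ⟨x, hx, y, hy, hxy, hxb, hyb, hgt⟩ := H ε hε e1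
  rw [mem_sphere_zero_iff_norm] at hx hy
  obtain ⟨s, hs⟩ := hcoord x
  obtain ⟨t, ht⟩ := hcoord y
  obtain ⟨p0, p1, p2⟩ := aux_est hb hv hfb hf hρ hx (by rw [hxb]; exact e2) hs
  obtain ⟨q0, q1, q2⟩ := aux_est hb hv hfb hf hρ hy (by rw [hyb]; exact e2) ht
  have hst := aux_opp hb hx hy hxy (hxb.trans hyb.symm) hs ht
  have u1 := aux_upper (h := x - b) (z := x - a) hr hc hρc (by rw [← hba]; abel)
    (by rw [hxb]; exact e3)
  have u2 := aux_upper (h := y - b) (z := y - a) hr hc hρc (by rw [← hba]; abel)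
    (by rw [hyb]; exact e3)
  rw [hxb] at p1 p2 u1
  rw [hyb] at q1 q2 u2
  have hsum : |s + t| ≤ 2 * (δ / 6 * ε) := by
    have h1 := abs_le.1 p2
    have h2 := abs_le.1 q2
    rw [abs_le]
    rcases mul_nonpos_iff.1 hst with ⟨h3, h4⟩ | ⟨h3, h4⟩
    · rw [abs_of_nonneg h3] at h1
      rw [abs_of_nonpos h4] at h2
      constructor <;> linarith
    · rw [abs_of_nonpos h3] at h1
      rw [abs_of_nonneg h4] at h2
      constructor <;> linarith
  have hvec : (x - b) + (y - b) = (s + t) • v - (2 - f x - f y) • b := by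
    have h1 : s • v = x - f x • b := by rw [eq_sub_iff_add_eq, add_comm]; exact hs.symm
    have h2 : t • v = y - f y • b := by rw [eq_sub_iff_add_eq, add_comm]; exact ht.symm
    rw [add_smul, h1, h2]; module
  have hn : ‖(x - b) + (y - b)‖ ≤ 4 * (δ / 6 * ε) := by
    rw [hvec]
    refine (norm_sub_le _ _).trans ?_
    rw [norm_smul, norm_smul, hv, hb, Real.norm_eq_abs, Real.norm_of_nonneg (by linarith)]
    linarith
  have hfin := (abs_le.1 (aux_bound fc hfc ((x - b) + (y - b)))).2
  rw [map_add] at hfin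
  linarith
end aux

/-- Let `X` be a strictly convex 2-dimensional real Banach space and `a, b, c ∈ S_X` with
`b` a smooth point and `0 ≠ b - a = ‖b - a‖ • c`.  Then `c` is non-smooth iff there are
`δ, ε₀ > 0` such that for every `0 < ε < ε₀` there exist distinct `x, y ∈ S_X` with
`‖x - b‖ = ε = ‖y - b‖` and `‖x - a‖ + ‖y - a‖ > 2‖b - a‖ + δ·ε`. -/
theorem nonsmooth_criterion
    {X : Type*} [NormedAddCommGroup X] [NormedSpace ℝ X] [CompleteSpace X]
    (hdim : Module.finrank ℝ X = 2)
    (hsc : StrictlyConvexSphere X)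
    (a b c : X) (ha : a ∈ sphere (0 : X) 1) (hb : b ∈ sphere (0 : X) 1)
    (hc : c ∈ sphere (0 : X) 1)
    (hb_smooth : IsSmoothPoint b)
    (hne : b - a ≠ 0) (heq : b - a = ‖b - a‖ • c) :
    ¬ IsSmoothPoint c ↔
      ∃ δ > (0:ℝ), ∃ ε₀ > (0:ℝ), ∀ ε : ℝ, 0 < ε → ε < ε₀ →
        ∃ x ∈ sphere (0 : X) 1, ∃ y ∈ sphere (0 : X) 1, x ≠ y ∧
          ‖x - b‖ = ε ∧ ‖y - b‖ = ε ∧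
          ‖x - a‖ + ‖y - a‖ > 2 * ‖b - a‖ + δ * ε := by
  have hfd : FiniteDimensional ℝ X := Module.finite_of_finrank_eq_succ hdim
  have hstrict : StrictConvexSpace ℝ X := aux_strict hsc
  rw [mem_sphere_zero_iff_norm] at ha hb hc
  obtain ⟨f, ⟨hfb, hf⟩, huniq⟩ := hb_smooth
  obtain ⟨v, hv, hfv, hcoord⟩ := aux_coord hdim hfb
  have hr : 0 < ‖b - a‖ := norm_pos_iff.2 hne
  constructor
  · intro hns
    have hfc : f c ≠ 0 := by
      intro h0
      have h1 : f (b - a) = 0 := by rw [heq, map_smul, h0, smul_zero]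
      rw [map_sub, hfb] at h1
      refine hne (sub_eq_zero.2 (hsc {x | f x = 1 ∧ ‖x‖ ≤ 1} ?_ ?_ ⟨hfb, hb.le⟩
        ⟨by linarith, ha.le⟩))
      · rintro x ⟨hx1, hx2⟩
        rw [mem_sphere_zero_iff_norm]
        refine le_antisymm hx2 ?_
        have := (abs_le.1 (aux_bound f hf.le x)).2
        linarith
      · rintro x ⟨hx1, hx2⟩ y ⟨hy1, hy2⟩ p q hp hq hpq
        refine ⟨by simp [hx1, hy1, hpq], ?_⟩
        have := (convex_closedBall (0 : X) 1) (mem_closedBall_zero_iff.2 hx2)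
          (mem_closedBall_zero_iff.2 hy2) hp hq hpq
        simpa using this
    obtain ⟨g₁, hg₁, h₁⟩ := aux_support c
    rw [hc] at h₁
    have hn : ‖g₁‖ = 1 := by
      refine le_antisymm hg₁ ?_
      have := g₁.le_opNorm c
      rw [h₁, hc] at this
      simpa using this
    have : ∃ g₂ : X →L[ℝ] ℝ, (g₂ c = 1 ∧ ‖g₂‖ = 1) ∧ g₂ ≠ g₁ := by
      by_contra hcon
      push Not at hcon
      exact hns ⟨g₁, ⟨h₁, hn⟩, hcon⟩
    obtain ⟨g₂, ⟨h₂, hg₂⟩, hne₂⟩ := this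
    have hvne : g₂ v ≠ g₁ v := by
      intro hvv
      apply hne₂
      obtain ⟨s, hs⟩ := hcoord c
      have e1 : g₁ c = f c * g₁ b + s * g₁ v := by
        conv_lhs => rw [hs]
        simp
      have e2 : g₂ c = f c * g₂ b + s * g₂ v := by
        conv_lhs => rw [hs]
        simp
      have e3 : g₂ b = g₁ b := by
        apply mul_left_cancel₀ hfc
        rw [hvv] at e2
        linarith
      ext x
      obtain ⟨t, ht⟩ := hcoord x
      rw [ht]
      simp [hvv, e3]
    rcases lt_or_gt_of_ne hvne with h | h
    · exact aux_forward hb hv hfb hf.le hfv huniq heq hg₁ hg₂.le h₁ h₂ h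
    · exact aux_forward hb hv hfb hf.le hfv huniq heq hg₂.le hg₁ h₂ h₁ h
  · rintro ⟨δ, hδ, ε₀, hε₀, H⟩ ⟨fc, ⟨-, hfc⟩, huniqc⟩
    exact aux_backward hr hb hc hv hfb hf.le hcoord huniq hfc.le huniqc heq hδ hε₀ H
end

section
/- Let X be a strictly convex 2-dimensional real Banach space and let u, v ∈ S_X be points such that the pair (u, v) is regular. Then for every point w ∈ S_X there exist points x, y, z ∈ S_X with x ≠ y such that x ∈ z + ℝ·u, y ∈ z + ℝ·v, and x − y = ‖x − y‖·w. -/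
open Metric Set

/-- A pair `(x, y)` of points of the unit sphere is *singular* if
`{x, -x} ∩ {y, -y} ≠ ∅` or there is `z ∈ S_X` with
`S_X ∩ (z + ℝ·x) = {z} = S_X ∩ (z + ℝ·y)`. -/
def SingularPair {X : Type*} [NormedAddCommGroup X] [NormedSpace ℝ X] (x y : X) : Prop :=
  (({x, -x} : Set X) ∩ ({y, -y} : Set X)).Nonempty ∨
    ∃ z ∈ sphere (0 : X) 1,
      sphere (0 : X) 1 ∩ {w : X | ∃ t : ℝ, w = z + t • x} = {z} ∧
      sphere (0 : X) 1 ∩ {w : X | ∃ t : ℝ, w = z + t • y} = {z}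

/-- `t` is the displacement from `z` to the second point of `S ∩ (z + ℝ u)`. -/
def OtherPt {X : Type*} [NormedAddCommGroup X] [NormedSpace ℝ X] (u z : X) (t : ℝ) : Prop :=
  ‖z + t • u‖ = 1 ∧ ∀ s : ℝ, 1 ≤ ‖z + s • u‖ ∨ s * (s - t) ≤ 0

lemma scs_of {X : Type*} [NormedAddCommGroup X] [NormedSpace ℝ X]
    (hsc : StrictlyConvexSphere X) : StrictConvexSpace ℝ X := by
  apply StrictConvexSpace.of_norm_combo_ne_one
  intro x y hx hy hxy
  by_contra! hcon
  refine hxy (hsc (segment ℝ x y) ?_ (convex_segment x y) (left_mem_segment ℝ x y)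
    (right_mem_segment ℝ x y))
  rintro p ⟨a, b, ha, hb, hab, rfl⟩
  simpa using hcon a b ha hb hab

lemma combo_lt {X : Type*} [NormedAddCommGroup X] [NormedSpace ℝ X] (u z : X) (a s θ r : ℝ)
    (ha : ‖z + a • u‖ ≤ 1) (hs : ‖z + s • u‖ < 1) (h0 : 0 < θ) (h1 : θ ≤ 1)
    (hr : r = (1 - θ) * a + θ * s) : ‖z + r • u‖ < 1 := by
  have e : z + r • u = (1 - θ) • (z + a • u) + θ • (z + s • u) := by
    rw [hr]; module
  rw [e]
  calc _ ≤ ‖(1 - θ) • (z + a • u)‖ + ‖θ • (z + s • u)‖ := norm_add_le _ _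
    _ = (1 - θ) * ‖z + a • u‖ + θ * ‖z + s • u‖ := by
      rw [norm_smul, norm_smul, Real.norm_of_nonneg h0.le, Real.norm_of_nonneg (by linarith)]
    _ < 1 := by nlinarith

lemma mid_lt {X : Type*} [NormedAddCommGroup X] [NormedSpace ℝ X] [StrictConvexSpace ℝ X]
    {u : X} (hu : ‖u‖ = 1) (z : X) {a b : ℝ}
    (ha : ‖z + a • u‖ = 1) (hb : ‖z + b • u‖ = 1) (hab : a ≠ b) :
    ‖z + ((a + b) / 2) • u‖ < 1 := by
  have hne : z + a • u ≠ z + b • u := by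
    intro h
    have h2 : (a - b) • u = 0 := by
      rw [sub_smul, add_left_cancel h, sub_self]
    rcases smul_eq_zero.1 h2 with h3 | h3
    · exact hab (by linarith)
    · simp [h3] at hu
  have := norm_combo_lt_of_ne ha.le hb.le hne (a := 1/2) (b := 1/2) (by norm_num) (by norm_num)
    (by norm_num)
  convert this using 2
  module

lemma OtherPt.unique {X : Type*} [NormedAddCommGroup X] [NormedSpace ℝ X] [StrictConvexSpace ℝ X]
    {u z : X} (hu : ‖u‖ = 1) (hz : ‖z‖ = 1) {t t' : ℝ} (h : OtherPt u z t) (h' : OtherPt u z t') :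
    t = t' := by
  by_contra hne
  have hm := mid_lt hu z h.1 h'.1 hne
  have h1 := (h.2 ((t + t') / 2)).resolve_left (not_le.2 hm)
  have h2 := (h'.2 ((t + t') / 2)).resolve_left (not_le.2 hm)
  have h3 : (t - t') * (t + t') = 0 := by nlinarith
  have h4 : t' = -t := by
    rcases mul_eq_zero.1 h3 with h | h
    · exact absurd (by linarith) hne
    · linarith
  have ht : t ≠ 0 := by
    rintro rfl
    simp at h4; exact hne h4.symm
  have hm2 := mid_lt hu z (a := 0) (by simpa using hz) h.1 (Ne.symm ht)
  have h5 := (h'.2 _).resolve_left (not_le.2 hm2)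
  rw [h4] at h5
  have := sq_pos_of_ne_zero ht
  nlinarith

lemma OtherPt.exists {X : Type*} [NormedAddCommGroup X] [NormedSpace ℝ X]
    {u z : X} (hu : ‖u‖ = 1) (hz : ‖z‖ = 1) : ∃ t, OtherPt u z t := by
  by_cases htan : ∀ s : ℝ, 1 ≤ ‖z + s • u‖
  · exact ⟨0, by simpa using hz, fun s => Or.inl (htan s)⟩
  push Not at htan
  obtain ⟨s₀, hs₀⟩ := htan
  have hs0 : s₀ ≠ 0 := by
    rintro rfl
    simp [hz] at hs₀
  have hpos : 0 < |s₀| := abs_pos.2 hs0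
  obtain ⟨r, hr, hr1⟩ : ∃ r ∈ Icc (1:ℝ) (1 + 2 / |s₀|), ‖z + (r * s₀) • u‖ = 1 := by
    have hc : ContinuousOn (fun r : ℝ => ‖z + (r * s₀) • u‖) (Icc (1:ℝ) (1 + 2 / |s₀|)) := by
      fun_prop
    have := intermediate_value_Icc (by have : 0 < 2 / |s₀| := by positivity
                                       linarith) hc
    apply this
    refine ⟨by simpa using hs₀.le, ?_⟩
    have h1 : ‖((1 + 2 / |s₀|) * s₀) • u‖ = |s₀| + 2 := by
      rw [norm_smul, hu, mul_one, Real.norm_eq_abs, abs_mul, abs_of_pos (by positivity)]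
      field_simp
    have h2 := norm_sub_norm_le (((1 + 2 / |s₀|) * s₀) • u) (-z)
    rw [norm_neg, hz, h1, sub_neg_eq_add, add_comm _ z] at h2
    show 1 ≤ _
    linarith
  have ht0 : r * s₀ ≠ 0 := mul_ne_zero (by linarith [hr.1]) hs0
  refine ⟨r * s₀, hr1, ?_⟩
  generalize r * s₀ = t at *
  intro s
  by_contra! hcon
  obtain ⟨hs, hst⟩ := hcon
  have hs0' : s ≠ 0 := by rintro rfl; simp at hst
  have key : 0 < t / s ∨ t / s < 0 := (lt_or_gt_of_ne (div_ne_zero ht0 hs0')).symm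
  have e : s * (s - t) = s ^ 2 * (1 - t / s) := by field_simp
  have hlt : t / s < 1 := by
    rw [e] at hst
    have := pos_of_mul_pos_right hst (sq_nonneg s) 
    linarith
  rcases key with hk | hk
  · have := combo_lt u z 0 s (t / s) t (by simp [hz]) hs hk hlt.le (by field_simp; ring)
    linarith
  · set q := t / s with hq
    have hts : t = q * s := by rw [hq]; field_simp
    have h1q : 1 - q ≠ 0 := by linarith
    have := combo_lt u z t s (-q / (1 - q)) 0 hr1.le hs (div_pos (by linarith) (by linarith))
      ((div_le_one (by linarith)).2 (by linarith)) (by rw [hts]; field_simp; ring)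
    simp [hz] at this

lemma OtherPt.neg {X : Type*} [NormedAddCommGroup X] [NormedSpace ℝ X]
    {u z : X} {t : ℝ} (h : OtherPt u z t) : OtherPt u (-z) (-t) := by
  refine ⟨?_, fun s => ?_⟩
  · rw [← h.1, ← norm_neg (z + t • u)]; congr 1; module
  · rcases h.2 (-s) with h | h
    · left
      have e : -z + s • u = -(z + (-s) • u) := by module
      rw [e, norm_neg]; exact h
    · right; linarith

lemma OtherPt.abs_le {X : Type*} [NormedAddCommGroup X] [NormedSpace ℝ X]
    {u z : X} (hu : ‖u‖ = 1) (hz : ‖z‖ = 1) {t : ℝ} (h : OtherPt u z t) : |t| ≤ 2 := by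
  have h2 := norm_sub_le (z + t • u) z
  rw [add_sub_cancel_left, norm_smul, hu, h.1, hz, Real.norm_eq_abs] at h2
  linarith

lemma OtherPt.tangent {X : Type*} [NormedAddCommGroup X] [NormedSpace ℝ X] [StrictConvexSpace ℝ X]
    {u z : X} (hu : ‖u‖ = 1) (hz : ‖z‖ = 1) (h : OtherPt u z 0) :
    sphere (0 : X) 1 ∩ {w : X | ∃ t : ℝ, w = z + t • u} = {z} := by
  ext p
  simp only [mem_inter_iff, mem_sphere_iff_norm, sub_zero, mem_ofPred_eq, mem_singleton_iff]
  constructor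
  · rintro ⟨hp, s, rfl⟩
    by_contra hne
    have hs : s ≠ 0 := by rintro rfl; simp at hne
    have hm := mid_lt hu z h.1 hp hs.symm
    have h5 := (h.2 _).resolve_left (not_le.2 hm)
    have := sq_pos_of_ne_zero hs
    nlinarith
  · rintro rfl
    exact ⟨hz, 0, by simp⟩

/-- The displacement is a continuous odd function on the sphere. -/
lemma exists_disp {X : Type*} [NormedAddCommGroup X] [NormedSpace ℝ X] [StrictConvexSpace ℝ X]
    {u : X} (hu : ‖u‖ = 1) : ∃ α : sphere (0 : X) 1 → ℝ, Continuous α ∧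
      (∀ z, α (-z) = - α z) ∧ ∀ z : sphere (0 : X) 1, OtherPt u (z : X) (α z) := by
  have hn : ∀ z : sphere (0 : X) 1, ‖(z : X)‖ = 1 := fun z => by simp
  choose α hα using fun z : sphere (0 : X) 1 => OtherPt.exists hu (hn z)
  refine ⟨α, ?_, fun z => ?_, hα⟩
  · let β : sphere (0 : X) 1 → Icc (-2 : ℝ) 2 := fun z => ⟨α z, abs_le.1 ((hα z).abs_le hu (hn z))⟩
    suffices hβ : Continuous β from continuous_subtype_val.comp hβ
    suffices hcl : IsClosed {p : sphere (0 : X) 1 × Icc (-2 : ℝ) 2 | p.2 = β p.1} by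
      rw [continuous_iff_isClosed]
      intro C hC
      have e : Set.preimage β C = Set.image Prod.fst
          ({p : sphere (0 : X) 1 × Icc (-2 : ℝ) 2 | p.2 = β p.1} ∩ Set.preimage Prod.snd C) := by
        ext z
        constructor
        · intro hz; exact ⟨(z, β z), ⟨rfl, hz⟩, rfl⟩
        · rintro ⟨⟨z', t⟩, ⟨h1, h2⟩, rfl⟩
          simp only [mem_ofPred_eq] at h1
          subst h1
          exact h2
      rw [e]
      exact isClosedMap_fst_of_compactSpace _ (hcl.inter (hC.preimage continuous_snd))
    have : {p : sphere (0 : X) 1 × Icc (-2 : ℝ) 2 | p.2 = β p.1} =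
        {p | ‖(p.1 : X) + (p.2 : ℝ) • u‖ = 1} ∩
        ⋂ s : ℝ, ({p | 1 ≤ ‖(p.1 : X) + s • u‖} ∪ {p | s * (s - (p.2 : ℝ)) ≤ 0}) := by
      ext ⟨z, t⟩
      simp only [mem_ofPred_eq, mem_inter_iff, mem_iInter, mem_union]
      constructor
      · rintro rfl; exact hα z
      · intro h; exact Subtype.ext (OtherPt.unique hu (hn z) h (hα z))
    rw [this]
    refine (isClosed_eq (by fun_prop) (by fun_prop)).inter (isClosed_iInter fun s => ?_)
    exact (isClosed_le (by fun_prop) (by fun_prop)).union (isClosed_le (by fun_prop) (by fun_prop))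
  · exact OtherPt.unique hu (hn (-z)) (hα (-z)) (by simpa using (hα z).neg)

/-- A continuous functional on a plane with kernel spanned by a nonzero vector `w`. -/
lemma exists_functional {X : Type*} [NormedAddCommGroup X] [NormedSpace ℝ X]
    (hdim : Module.finrank ℝ X = 2) (w : X) (hw : w ≠ 0) :
    ∃ φ : X →ₗ[ℝ] ℝ, Continuous φ ∧ ∀ x, φ x = 0 → ∃ c : ℝ, x = c • w := by
  have : FiniteDimensional ℝ X := Module.finite_of_finrank_pos (by omega)
  let e : X ≃ₗ[ℝ] (Fin 2 → ℝ) := LinearEquiv.ofFinrankEq _ _ (by simp [hdim])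
  let π : Fin 2 → X →ₗ[ℝ] ℝ := fun i => (LinearMap.proj i).comp e.toLinearMap
  refine ⟨e w 0 • π 1 - e w 1 • π 0, LinearMap.continuous_of_finiteDimensional _, fun x hx => ?_⟩
  have hx' : e w 0 * e x 1 - e w 1 * e x 0 = 0 := by simpa [π] using hx
  have hne : e w 0 ≠ 0 ∨ e w 1 ≠ 0 := by
    by_contra! h
    apply hw
    apply e.injective
    ext i; fin_cases i <;> simp [h.1, h.2]
  rcases hne with h | h
  · refine ⟨e x 0 / e w 0, e.injective ?_⟩
    ext i; fin_cases i <;> simp <;> field_simp <;> linarith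
  · refine ⟨e x 1 / e w 1, e.injective ?_⟩
    ext i; fin_cases i <;> simp <;> field_simp <;> linarith

theorem regular_pair_realizes_directions
    {X : Type*} [NormedAddCommGroup X] [NormedSpace ℝ X] [CompleteSpace X]
    (hdim : Module.finrank ℝ X = 2)
    (hsc : StrictlyConvexSphere X)
    (u v : X) (hu : u ∈ sphere (0 : X) 1) (hv : v ∈ sphere (0 : X) 1)
    (hreg : ¬ SingularPair u v) :
    ∀ w ∈ sphere (0 : X) 1,
      ∃ x ∈ sphere (0 : X) 1, ∃ y ∈ sphere (0 : X) 1, ∃ z ∈ sphere (0 : X) 1,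
        x ≠ y ∧ (∃ t : ℝ, x = z + t • u) ∧ (∃ t : ℝ, y = z + t • v) ∧
        x - y = ‖x - y‖ • w := by
  intro w hw
  haveI := scs_of hsc
  have hu1 : ‖u‖ = 1 := by simpa using hu
  have hv1 : ‖v‖ = 1 := by simpa using hv
  have hw1 : ‖w‖ = 1 := by simpa using hw
  obtain ⟨α, hαc, hαo, hα⟩ := exists_disp hu1
  obtain ⟨β, hβc, hβo, hβ⟩ := exists_disp hv1
  obtain ⟨φ, hφc, hφ⟩ := exists_functional hdim w (by rintro rfl; simp at hw1)
  have hn : ∀ z : sphere (0 : X) 1, ‖(z : X)‖ = 1 := fun z => by simp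
  have hne : ∀ z, α z • u - β z • v ≠ 0 := by
    intro z h0
    apply hreg
    have h1 : α z • u = β z • v := sub_eq_zero.1 h0
    have h2 : |α z| = |β z| := by
      have := congrArg norm h1
      simpa [norm_smul, hu1, hv1] using this
    by_cases ha : α z = 0
    · have hb : β z = 0 := by rw [ha] at h2; simpa using h2.symm
      right
      exact ⟨z, z.2, (ha ▸ hα z).tangent hu1 (hn z), (hb ▸ hβ z).tangent hv1 (hn z)⟩
    · left
      rcases abs_eq_abs.1 h2 with h | h
      · have : u = v := by
          rw [← h] at h1; exact smul_right_injective X ha h1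
        exact ⟨u, by simp, by simp [this]⟩
      · have : u = -v := by
          apply smul_right_injective X ha
          show α z • u = α z • (-v)
          rw [h1, h]; simp
        exact ⟨u, by simp, by simp [this]⟩
  let g : sphere (0 : X) 1 → ℝ := fun z => φ (α z • u - β z • v)
  have hgc : Continuous g := by
    apply hφc.comp
    fun_prop
  have hgo : ∀ z, g (-z) = - g z := by
    intro z
    simp only [g, hαo, hβo, ← map_neg]
    congr 1; module
  have hconn : IsPreconnected (sphere (0 : X) 1) := by
    apply isPreconnected_sphere
    have := Module.lt_rank_of_lt_finrank (R := ℝ) (M := X) (n := 1) (by omega)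
    exact_mod_cast this
  haveI : PreconnectedSpace (sphere (0 : X) 1) := Subtype.preconnectedSpace hconn
  obtain ⟨z, hz⟩ : ∃ z, g z = 0 := by
    let z₀ : sphere (0 : X) 1 := ⟨u, hu⟩
    have h := hgo z₀
    rcases le_total (g z₀) 0 with h0 | h0
    · exact mem_range_of_exists_le_of_exists_ge hgc ⟨z₀, h0⟩ ⟨-z₀, by linarith⟩
    · exact mem_range_of_exists_le_of_exists_ge hgc ⟨-z₀, by linarith⟩ ⟨z₀, h0⟩
  obtain ⟨c, hc⟩ := hφ _ hz
  have main : ∀ (z : sphere (0 : X) 1) (c : ℝ), 0 ≤ c → α z • u - β z • v = c • w →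
      ∃ x ∈ sphere (0 : X) 1, ∃ y ∈ sphere (0 : X) 1, ∃ z ∈ sphere (0 : X) 1,
        x ≠ y ∧ (∃ t : ℝ, x = z + t • u) ∧ (∃ t : ℝ, y = z + t • v) ∧
        x - y = ‖x - y‖ • w := by
    intro z c hc0 hc
    have e : ((z : X) + α z • u) - (z + β z • v) = α z • u - β z • v := by module
    refine ⟨z + α z • u, by simpa using (hα z).1, z + β z • v, by simpa using (hβ z).1, z, z.2,
      ?_, ⟨_, rfl⟩, ⟨_, rfl⟩, ?_⟩
    · intro h
      exact hne z (by rw [← e, h, sub_self])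
    · rw [e, hc, norm_smul, hw1, Real.norm_of_nonneg hc0, mul_one]
  rcases le_total 0 c with h | h
  · exact main z c h hc
  · refine main (-z) (-c) (by linarith) ?_
    rw [hαo, hβo, neg_smul, neg_smul, neg_smul, ← hc]; module
end
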